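/- Define S₂((1+ix)/2) = π²x[1/6 − ∑_{m=1}^∞ 1/sinh²(πmx) + ∑_{m=1}^∞ 1/cosh²(πx(m−1/2))] for x > 0. If x = K(k′)/K(k), k ∈ (0,1), k′ = √(1−k²), then S₂((1+ix)/2) = 2K(k′)[2E(k) + ((4k²−5)/3)K(k)]. -/

import Mathlib

open Real

/-- The complete elliptic integral of the first kind. -/
noncomputable def ellipticK (k : ℝ) : ℝ :=
  ∫ t in (0:ℝ)..1, 1 / Real.sqrt ((1 - t ^ 2) * (1 - k ^ 2 * t ^ 2))

/-- The complete elliptic integral of the second kind. -/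
noncomputable def ellipticE (k : ℝ) : ℝ :=
  ∫ t in (0:ℝ)..1, Real.sqrt ((1 - k ^ 2 * t ^ 2) / (1 - t ^ 2))

/-- The ratio of elliptic integrals with complementary modulus. -/
noncomputable def xRatio (k : ℝ) : ℝ :=
  ellipticK (Real.sqrt (1 - k ^ 2)) / ellipticK k

/-- The lattice sum at the point `(1 + i x)/2` of the upper half plane. -/
noncomputable def S2half (x : ℝ) : ℝ :=
  π ^ 2 * x * (1 / 6 - (∑' m : ℕ+, 1 / Real.sinh (π * m * x) ^ 2) +
    ∑' m : ℕ+, 1 / Real.cosh (π * x * ((m : ℝ) - 1 / 2)) ^ 2)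

open Filter Topology

/-! ### Sums over the integers -/

lemma hasSum_int_of_even_odd {f : ℤ → ℂ} {A B : ℂ} (he : HasSum (fun k : ℤ => f (2 * k)) A)
    (ho : HasSum (fun k : ℤ => f (2 * k + 1)) B) : HasSum f (A + B) := by
  have h1 : Function.Injective (fun k : ℤ => 2 * k) := fun x y h => by simpa using h
  have h2 : Function.Injective (fun k : ℤ => 2 * k + 1) := fun x y h => by simpa using h
  refine (h1.hasSum_range_iff.2 he).add_isCompl ?_ (h2.hasSum_range_iff.2 ho)
  constructor
  · rw [Set.disjoint_left]
    rintro _ ⟨x, rfl⟩ ⟨y, hy⟩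
    simp only at hy
    omega
  · rw [codisjoint_iff_le_sup]
    intro n _
    obtain ⟨x, hx | hx⟩ := Int.even_or_odd' n
    · exact Or.inl ⟨x, hx.symm⟩
    · exact Or.inr ⟨x, hx.symm⟩

lemma hasSum_sub_of_tendsto {E : Type*} [NormedAddCommGroup E] [CompleteSpace E] {f : ℤ → E}
    {l l' : E}
    (hs : Summable fun n : ℤ => f (n + 1) - f n)
    (h : Tendsto (fun n : ℕ => f n) atTop (𝓝 l))
    (h' : Tendsto (fun n : ℕ => f (-n)) atTop (𝓝 l')) :
    HasSum (fun n : ℤ => f (n + 1) - f n) (l - l') := by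
  have s1 : Summable fun n : ℕ => f ((n : ℤ) + 1) - f n := hs.comp_injective Nat.cast_injective
  have s2 : Summable fun n : ℕ => f (-((n : ℤ) + 1) + 1) - f (-((n : ℤ) + 1)) :=
    hs.comp_injective (i := fun n : ℕ => -((n : ℤ) + 1)) fun x y h => by simpa using h
  have t1 : Tendsto (fun N : ℕ => ∑ i ∈ Finset.range N, (f ((i : ℤ) + 1) - f i)) atTop
      (𝓝 (l - f 0)) := by
    have : ∀ N : ℕ, ∑ i ∈ Finset.range N, (f ((i : ℤ) + 1) - f i) = f N - f 0 := fun N => by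
      have := Finset.sum_range_sub (fun i : ℕ => f i) N
      simpa using this
    simp_rw [this]
    exact h.sub_const _
  have t2 : Tendsto (fun N : ℕ => ∑ i ∈ Finset.range N,
      (f (-((i : ℤ) + 1) + 1) - f (-((i : ℤ) + 1)))) atTop (𝓝 (f 0 - l')) := by
    have : ∀ N : ℕ, ∑ i ∈ Finset.range N, (f (-((i : ℤ) + 1) + 1) - f (-((i : ℤ) + 1)))
        = f 0 - f (-N) := fun N => by
      have := Finset.sum_range_sub' (fun i : ℕ => f (-i)) N
      simp only [Nat.cast_add, Nat.cast_one, Nat.cast_zero, neg_zero] at this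
      rw [← this]
      exact Finset.sum_congr rfl fun i _ => by congr 2; ring
    simp_rw [this]
    exact h'.const_sub _
  have e1 := tendsto_nhds_unique s1.hasSum.tendsto_sum_nat t1
  have e2 := tendsto_nhds_unique s2.hasSum.tendsto_sum_nat t2
  have := HasSum.of_nat_of_neg_add_one (f := fun n : ℤ => f (n + 1) - f n)
    (e1 ▸ s1.hasSum) (e2 ▸ s2.hasSum)
  convert this using 1
  abel

/-- The shear `(m, d) ↦ (m, m + d)` of `ℤ × ℤ`. -/
def intShear : ℤ × ℤ ≃ ℤ × ℤ where
  toFun z := (z.1, z.1 + z.2)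
  invFun z := (z.1, z.2 - z.1)
  left_inv z := by simp
  right_inv z := by simp

lemma hasSum_mul_prod {f g : ℤ → ℂ} (hf : Summable f) (hg : Summable g) :
    HasSum (fun z : ℤ × ℤ => f z.1 * g z.2) ((∑' m, f m) * ∑' n, g n) := by
  rw [tsum_mul_tsum_of_summable_norm hf.norm hg.norm]
  exact (summable_mul_of_summable_norm hf.norm hg.norm).hasSum

lemma hasSum_mul_fst_sub {f g : ℤ → ℂ} (hf : Summable f) (hg : Summable g) :
    HasSum (fun z : ℤ × ℤ => f z.1 * g (z.2 - z.1)) ((∑' m, f m) * ∑' n, g n) := by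
  have := hasSum_mul_prod hf hg
  rw [← intShear.symm.hasSum_iff] at this
  exact this

lemma hasSum_mul_snd_sub {f g : ℤ → ℂ} (hf : Summable f) (hg : Summable g) :
    HasSum (fun z : ℤ × ℤ => f z.2 * g (z.2 - z.1)) ((∑' m, f m) * ∑' n, g n) := by
  have h2 := hasSum_mul_fst_sub (g := fun n => g (-n)) hf ((Equiv.neg ℤ).summable_iff.2 hg)
  have e : ∑' n, g (-n) = ∑' n, g n := (Equiv.neg ℤ).tsum_eq g
  rw [e, ← (Equiv.prodComm ℤ ℤ).hasSum_iff] at h2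
  simpa [Function.comp_def] using h2

lemma hasSum_diag {h : ℤ → ℂ} (hh : Summable h) :
    HasSum (fun z : ℤ × ℤ => if z.1 = z.2 then h z.1 else 0) (∑' n, h n) := by
  have hi : Function.Injective (fun n : ℤ => (n, n)) := fun x y h => by simpa using h
  rw [← hi.hasSum_iff]
  · simpa [Function.comp_def] using hh.hasSum
  · rintro ⟨x, y⟩ hxy
    have : x ≠ y := fun e => hxy ⟨x, by simp [e]⟩
    simp [this]

lemma tsum_eq_zero_of_odd {f : ℤ → ℂ} (e : ℤ ≃ ℤ) (h : ∀ n, f (e n) = -f n) :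
    ∑' n, f n = 0 := by
  have h1 : ∑' n, f n = -∑' n, f n := by
    conv_lhs => rw [← e.tsum_eq f]
    simp_rw [h]
    exact tsum_neg
  exact self_eq_neg.1 h1

lemma summable_exp_neg_mul_abs {a : ℝ} (ha : 0 < a) :
    Summable fun n : ℤ => exp (-(a * |(n : ℝ)|)) := by
  have h : Summable fun n : ℕ => exp (-(a * n)) := by
    have := summable_geometric_of_lt_one (exp_pos (-a)).le (by simpa using ha)
    refine this.congr fun n => ?_
    rw [← Real.exp_nat_mul]; congr 1; ring
  refine Summable.of_nat_of_neg ?_ ?_ <;> simpa using h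

/-! ### Hyperbolic identities -/

lemma tanh_sub_tanh_eq {p q : ℂ} (hp : Complex.cosh p ≠ 0) (hq : Complex.cosh q ≠ 0) :
    Complex.tanh p - Complex.tanh q
      = Complex.sinh (p - q) * ((Complex.cosh p)⁻¹ * (Complex.cosh q)⁻¹) := by
  rw [Complex.tanh_eq_sinh_div_cosh, Complex.tanh_eq_sinh_div_cosh, Complex.sinh_sub]
  field_simp

lemma coth_sub_coth_eq {p q : ℂ} (hp : Complex.sinh p ≠ 0) (hq : Complex.sinh q ≠ 0) :
    Complex.cosh p * (Complex.sinh p)⁻¹ - Complex.cosh q * (Complex.sinh q)⁻¹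
      = Complex.sinh (q - p) * ((Complex.sinh p)⁻¹ * (Complex.sinh q)⁻¹) := by
  rw [Complex.sinh_sub]
  field_simp

lemma tanh_mul_inv_cosh_eq {p v : ℂ} (hp : Complex.cosh p ≠ 0) (hv : Complex.cosh v ≠ 0)
    (h : Complex.sinh (v - p) ≠ 0) :
    Complex.tanh p * (Complex.cosh v)⁻¹ = (Complex.cosh p)⁻¹ * (Complex.sinh (v - p))⁻¹
      - Complex.cosh (v - p) * (Complex.sinh (v - p))⁻¹ * (Complex.cosh v)⁻¹ := by
  have e : Complex.cosh v = Complex.cosh p * Complex.cosh (v - p)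
      + Complex.sinh p * Complex.sinh (v - p) := by
    rw [← Complex.cosh_add]; congr 1; ring
  rw [Complex.tanh_eq_sinh_div_cosh]
  field_simp
  rw [e]; ring

lemma hasDerivAt_tanh {z : ℂ} (hz : Complex.cosh z ≠ 0) :
    HasDerivAt Complex.tanh ((Complex.cosh z)⁻¹ ^ 2) z := by
  have h := (Complex.hasDerivAt_sinh z).div (Complex.hasDerivAt_cosh z) hz
  have e : (Complex.cosh z * Complex.cosh z - Complex.sinh z * Complex.sinh z)
      / Complex.cosh z ^ 2 = (Complex.cosh z)⁻¹ ^ 2 := by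
    rw [← sq, ← sq, Complex.cosh_sq_sub_sinh_sq, one_div, inv_pow]
  rw [e] at h
  exact h

lemma hasDerivAt_inv_cosh {z : ℂ} (hz : Complex.cosh z ≠ 0) :
    HasDerivAt (fun w => (Complex.cosh w)⁻¹)
      (-(Complex.tanh z * (Complex.cosh z)⁻¹)) z := by
  refine ((Complex.hasDerivAt_cosh z).fun_inv hz).congr_deriv ?_
  rw [Complex.tanh_eq_sinh_div_cosh]; field_simp

lemma norm_sinh_ofReal (y : ℝ) : ‖Complex.sinh y‖ = |sinh y| := by
  rw [← Complex.ofReal_sinh, Complex.norm_real, Real.norm_eq_abs]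

lemma abs_half_le {n : ℤ} {s : ℝ} (hs : s = 0 ∨ s = 1 / 2 ∨ s = -(1 / 2)) (h : n + s ≠ 0) :
    1 / 2 ≤ |n + s| ∧ |(n : ℝ)| - 1 / 2 ≤ |n + s| := by
  constructor
  · rcases lt_trichotomy n 0 with hn | rfl | hn
    · have : (n : ℝ) ≤ -1 := by exact_mod_cast (by lia : n ≤ -1)
      have := neg_le_abs (n + s)
      rcases hs with rfl | rfl | rfl <;> linarith
    · rcases hs with rfl | rfl | rfl
      · simp at h
      all_goals norm_num [abs_of_pos]
    · have : (1 : ℝ) ≤ n := by exact_mod_cast hn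
      have := le_abs_self (n + s)
      rcases hs with rfl | rfl | rfl <;> linarith
  · have h1 : |(n : ℝ)| ≤ |n + s| + |s| := by
      have := abs_sub (n + s) s
      simpa using this
    have h2 : |s| ≤ 1 / 2 := by
      rcases hs with rfl | rfl | rfl <;> norm_num [abs_of_pos]
    linarith

/-- A constant controlling the exponential decay of `csch` on a half-integral lattice. -/
noncomputable def cschConst (b : ℝ) : ℝ := 2 * exp (b / 2) / (1 - exp (-b))

lemma cschConst_pos {b : ℝ} (hb : 0 < b) : 0 < cschConst b := by
  have : exp (-b) < 1 := by simpa using hb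
  have : 0 < 1 - exp (-b) := by linarith
  unfold cschConst; positivity

lemma inv_abs_sinh_le {b : ℝ} (hb : 0 < b) {n : ℤ} {s : ℝ}
    (hs : s = 0 ∨ s = 1 / 2 ∨ s = -(1 / 2)) :
    |sinh ((n + s) * b)|⁻¹ ≤ cschConst b * exp (-(b * |(n : ℝ)|)) := by
  by_cases h : (n : ℝ) + s = 0
  · have := cschConst_pos hb
    rw [h]; simp; positivity
  obtain ⟨h1, h2⟩ := abs_half_le hs h
  have e1 : exp (-b) < 1 := by simpa using hb
  have e2 : 0 < 1 - exp (-b) := by linarith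
  have key : exp (b * |(n : ℝ)| - b / 2) * (1 - exp (-b)) / 2 ≤ |sinh ((n + s) * b)| := by
    rw [abs_sinh, abs_mul, abs_of_pos hb, sinh_eq]
    have : exp (|n + s| * b) - exp (-(|n + s| * b))
        = exp (|n + s| * b) * (1 - exp (-(2 * (|n + s| * b)))) := by
      rw [mul_sub, mul_one, ← exp_add]; congr 2; ring
    rw [this]
    gcongr
    · nlinarith
    · nlinarith
  rw [cschConst, inv_le_comm₀ (lt_of_lt_of_le (by positivity) key) (by positivity)]
  refine le_trans (le_of_eq ?_) key
  rw [exp_sub, exp_neg, exp_neg]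
  field_simp

lemma norm_inv_sinh_le {b : ℝ} (hb : 0 < b) {n : ℤ} {s : ℝ}
    (hs : s = 0 ∨ s = 1 / 2 ∨ s = -(1 / 2)) :
    ‖(Complex.sinh ((n + s) * b))⁻¹‖ ≤ cschConst b * exp (-(b * |(n : ℝ)|)) := by
  rw [norm_inv]
  have := norm_sinh_ofReal ((n + s) * b)
  push_cast at this
  rw [this]
  exact inv_abs_sinh_le hb hs

lemma summable_inv_sinh {b : ℝ} (hb : 0 < b) {s : ℝ}
    (hs : s = 0 ∨ s = 1 / 2 ∨ s = -(1 / 2)) :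
    Summable fun n : ℤ => (Complex.sinh ((n + s) * b))⁻¹ :=
  ((summable_exp_neg_mul_abs hb).mul_left _).of_norm_bounded fun _ => norm_inv_sinh_le hb hs

lemma sinh_ofReal_ne_zero {y : ℝ} (h : y ≠ 0) : Complex.sinh y ≠ 0 := by
  rw [← Complex.ofReal_sinh]
  exact_mod_cast sinh_ne_zero.2 h

/-! ### Lattice sums of hyperbolic functions -/

/-- The sum of `sech` over the translates of `u` by the multiples of `a`. -/
noncomputable def sechSum (a : ℝ) (u : ℂ) : ℂ := ∑' n : ℤ, (Complex.cosh (u + n * a))⁻¹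

/-- The sum of `sech²` over the translates of `u` by the multiples of `a`. -/
noncomputable def sechSqSum (a : ℝ) (u : ℂ) : ℂ := ∑' n : ℤ, (Complex.cosh (u + n * a))⁻¹ ^ 2

/-- The sum of `sech · tanh` over the translates of `u` by the multiples of `a`. -/
noncomputable def tanhSechSum (a : ℝ) (u : ℂ) : ℂ :=
  ∑' n : ℤ, Complex.tanh (u + n * a) * (Complex.cosh (u + n * a))⁻¹

/-- The alternating sum of `tanh` over the translates of `u` by the multiples of `b / 2`,
written as an absolutely convergent sum over the translates by the multiples of `b`. -/
noncomputable def tanhSum (b : ℝ) (u : ℂ) : ℂ :=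
  ∑' n : ℤ, (Complex.tanh (u + n * b) -
    (Complex.tanh (u + b / 2 + n * b) + Complex.tanh (u - b / 2 + n * b)) / 2)

/-- The translates of `u` by the multiples of `a` stay away from the poles of `sech`, and `sech`
decays exponentially along them. -/
def SechBound (a M : ℝ) (u : ℂ) : Prop :=
  ∀ n : ℤ, Complex.cosh (u + n * a) ≠ 0 ∧
    ‖(Complex.cosh (u + n * a))⁻¹‖ ≤ M * exp (-(a * |(n : ℝ)|))

namespace SechBound

variable {a M : ℝ} {u : ℂ}

lemma nonneg (h : SechBound a M u) : 0 ≤ M := by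
  have := (norm_nonneg _).trans (h 0).2
  simpa using this

lemma norm_le (h : SechBound a M u) (ha : 0 < a) (n : ℤ) :
    ‖(Complex.cosh (u + n * a))⁻¹‖ ≤ M := by
  refine (h n).2.trans (mul_le_of_le_one_right h.nonneg ?_)
  rw [exp_le_one_iff]
  have : 0 ≤ a * |(n : ℝ)| := by positivity
  linarith

lemma mono (h : SechBound a M u) {M' : ℝ} (hM : M ≤ M') : SechBound a M' u := fun n =>
  ⟨(h n).1, (h n).2.trans (by gcongr)⟩

lemma summable (h : SechBound a M u) (ha : 0 < a) :
    Summable fun n : ℤ => (Complex.cosh (u + n * a))⁻¹ :=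
  ((summable_exp_neg_mul_abs ha).mul_left _).of_norm_bounded fun n => (h n).2

lemma norm_sq_le (h : SechBound a M u) (ha : 0 < a) (n : ℤ) :
    ‖(Complex.cosh (u + n * a))⁻¹ ^ 2‖ ≤ M * (M * exp (-(a * |(n : ℝ)|))) := by
  rw [norm_pow, sq]
  exact mul_le_mul (h.norm_le ha n) (h n).2 (norm_nonneg _) h.nonneg

lemma summable_sq (h : SechBound a M u) (ha : 0 < a) :
    Summable fun n : ℤ => (Complex.cosh (u + n * a))⁻¹ ^ 2 :=
  (((summable_exp_neg_mul_abs ha).mul_left _).mul_left _).of_norm_bounded (h.norm_sq_le ha)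

lemma norm_tanh_le (h : SechBound a M u) (ha : 0 < a) (n : ℤ) :
    ‖Complex.tanh (u + n * a)‖ ≤ 1 + M := by
  have hM := h.nonneg
  have e : Complex.tanh (u + n * a) ^ 2 = 1 - (Complex.cosh (u + n * a))⁻¹ ^ 2 := by
    have := (h n).1
    rw [Complex.tanh_eq_sinh_div_cosh]
    field_simp
    rw [Complex.cosh_sq]; ring
  have h1 : ‖Complex.tanh (u + n * a)‖ ^ 2 ≤ (1 + M) ^ 2 := by
    rw [← norm_pow, e]
    refine (norm_sub_le _ _).trans ?_
    rw [norm_one, norm_pow]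
    have := pow_le_pow_left₀ (norm_nonneg _) (h.norm_le ha n) 2
    nlinarith
  exact le_of_sq_le_sq h1 (by positivity)

lemma norm_tanh_mul_le (h : SechBound a M u) (ha : 0 < a) (n : ℤ) :
    ‖Complex.tanh (u + n * a) * (Complex.cosh (u + n * a))⁻¹‖
      ≤ (1 + M) * (M * exp (-(a * |(n : ℝ)|))) := by
  have := h.nonneg
  rw [norm_mul]
  exact mul_le_mul (h.norm_tanh_le ha n) (h n).2 (norm_nonneg _) (by positivity)

lemma summable_tanh_mul (h : SechBound a M u) (ha : 0 < a) :
    Summable fun n : ℤ => Complex.tanh (u + n * a) * (Complex.cosh (u + n * a))⁻¹ :=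
  (((summable_exp_neg_mul_abs ha).mul_left _).mul_left _).of_norm_bounded (h.norm_tanh_mul_le ha)

lemma add_int_mul (h : SechBound a M u) (ha : 0 < a) (d : ℤ) :
    SechBound a (M * exp (a * |(d : ℝ)|)) (u + d * a) := fun n => by
  have e : u + d * a + n * a = u + ((d + n : ℤ) : ℂ) * a := by push_cast; ring
  rw [e]
  refine ⟨(h _).1, (h _).2.trans ?_⟩
  rw [mul_assoc, ← exp_add]
  have : |(n : ℝ)| ≤ |((d + n : ℤ) : ℝ)| + |(d : ℝ)| := by
    have := abs_sub ((d + n : ℤ) : ℝ) d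
    push_cast at this ⊢
    simpa using this
  have := h.nonneg
  gcongr
  nlinarith

lemma two_mul (h : SechBound a M u) : SechBound (2 * a) M u := fun n => by
  have e : u + n * ((2 * a : ℝ) : ℂ) = u + ((2 * n : ℤ) : ℂ) * a := by push_cast; ring
  rw [e]
  refine ⟨(h _).1, (h _).2.trans (le_of_eq ?_)⟩
  push_cast
  rw [abs_mul, abs_two]; congr 2; ring

end SechBound

lemma sechSum_add_period (a : ℝ) (u : ℂ) : sechSum a (u + a) = sechSum a u := by
  unfold sechSum
  rw [← (Equiv.addRight (1 : ℤ)).tsum_eq fun n : ℤ => (Complex.cosh (u + n * a))⁻¹]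
  refine tsum_congr fun n => ?_
  simp only [Equiv.coe_addRight]; push_cast; ring_nf

lemma sechSqSum_add_period (a : ℝ) (u : ℂ) : sechSqSum a (u + a) = sechSqSum a u := by
  unfold sechSqSum
  rw [← (Equiv.addRight (1 : ℤ)).tsum_eq fun n : ℤ => (Complex.cosh (u + n * a))⁻¹ ^ 2]
  refine tsum_congr fun n => ?_
  simp only [Equiv.coe_addRight]; push_cast; ring_nf

lemma sechSum_neg (a : ℝ) (u : ℂ) : sechSum a (-u) = sechSum a u := by
  unfold sechSum
  rw [← (Equiv.neg ℤ).tsum_eq fun n : ℤ => (Complex.cosh (u + n * a))⁻¹]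
  refine tsum_congr fun n => ?_
  rw [← Complex.cosh_neg]; simp only [Equiv.neg_apply]; push_cast; ring_nf

lemma tanhSum_neg (b : ℝ) (u : ℂ) : tanhSum b (-u) = -tanhSum b u := by
  unfold tanhSum
  rw [← (Equiv.neg ℤ).tsum_eq, ← tsum_neg]
  refine tsum_congr fun n => ?_
  simp only [Equiv.neg_apply]
  have e1 : -u + ((-n : ℤ) : ℂ) * b = -(u + n * b) := by push_cast; ring
  have e2 : -u + b / 2 + ((-n : ℤ) : ℂ) * b = -(u - b / 2 + n * b) := by push_cast; ring
  have e3 : -u - b / 2 + ((-n : ℤ) : ℂ) * b = -(u + b / 2 + n * b) := by push_cast; ring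
  rw [e1, e2, e3, Complex.tanh_neg, Complex.tanh_neg, Complex.tanh_neg]; ring

lemma sechSum_conj (a : ℝ) (u : ℂ) :
    sechSum a (starRingEnd ℂ u) = starRingEnd ℂ (sechSum a u) := by
  unfold sechSum
  rw [Complex.conj_tsum]
  refine tsum_congr fun n => ?_
  rw [map_inv₀, ← Complex.cosh_conj]; simp

lemma tanhSum_conj (b : ℝ) (u : ℂ) :
    tanhSum b (starRingEnd ℂ u) = starRingEnd ℂ (tanhSum b u) := by
  unfold tanhSum
  rw [Complex.conj_tsum]
  refine tsum_congr fun n => ?_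
  have h2 : starRingEnd ℂ 2 = 2 := map_ofNat _ 2
  simp [← Complex.tanh_conj, h2]

lemma sechSum_two_mul {a M : ℝ} {u : ℂ} (ha : 0 < a) (h : SechBound a M u) :
    sechSum a u = sechSum (2 * a) u + sechSum (2 * a) (u + a) := by
  have h2 : 0 < 2 * a := by positivity
  have hs := (h.add_int_mul ha 1).two_mul.summable h2
  have h1 := h.two_mul.summable h2
  simp only [Int.cast_one, one_mul] at hs
  refine (hasSum_int_of_even_odd (f := fun n : ℤ => (Complex.cosh (u + n * a))⁻¹) ?_ ?_).tsum_eq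
  · refine h1.hasSum.congr_fun fun n => ?_
    push_cast; ring_nf
  · refine hs.hasSum.congr_fun fun n => ?_
    push_cast; ring_nf

/-- The `tanh`s telescope along the lattice. -/
lemma hasSum_tanh_sub {a M : ℝ} {u : ℂ} (ha : 0 < a) (h : SechBound a M u) (d : ℤ) :
    HasSum (fun n : ℤ => Complex.tanh (u + ((n + d : ℤ) : ℂ) * a) - Complex.tanh (u + n * a))
      (2 * d) := by
  have hM := h.nonneg
  have step : HasSum (fun n : ℤ =>
      Complex.tanh (u + ((n + 1 : ℤ) : ℂ) * a) - Complex.tanh (u + n * a)) (1 - (-1)) := by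
    have hlim : Tendsto (fun n : ℕ => M * exp (-(a * n))) atTop (𝓝 0) := by
      rw [← mul_zero M]
      refine Tendsto.const_mul _ (tendsto_exp_neg_atTop_nhds_zero.comp ?_)
      exact tendsto_natCast_atTop_atTop.const_mul_atTop ha
    refine hasSum_sub_of_tendsto (f := fun n : ℤ => Complex.tanh (u + n * a)) ?_ ?_ ?_
    · refine (((summable_exp_neg_mul_abs ha).mul_left M).mul_left
        (‖Complex.sinh a‖ * M)).of_norm_bounded fun n => ?_
      rw [tanh_sub_tanh_eq (h _).1 (h _).1, norm_mul, norm_mul, ← mul_assoc]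
      have e : u + ((n + 1 : ℤ) : ℂ) * a - (u + n * a) = a := by push_cast; ring
      rw [e]
      have := h.norm_le ha (n + 1)
      have := (h n).2
      gcongr
    · rw [tendsto_iff_norm_sub_tendsto_zero]
      refine squeeze_zero (fun _ => norm_nonneg _) (fun n => ?_)
        (by simpa using hlim.const_mul (exp (-u.re)))
      have h0 := (h n).1
      have e : Complex.tanh (u + (n : ℤ) * a) - 1
          = -(Complex.exp (-(u + (n : ℤ) * a)) * (Complex.cosh (u + (n : ℤ) * a))⁻¹) := by
        rw [← Complex.cosh_sub_sinh, Complex.tanh_eq_sinh_div_cosh]; field_simp; ring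
      rw [e, norm_neg, norm_mul, Complex.norm_exp]
      have h3 := (h n).2
      have h4 : (-(u + ((n : ℤ) : ℂ) * a)).re ≤ -u.re := by simp; positivity
      simp only [Int.cast_natCast, Nat.abs_cast] at h3 h4 ⊢
      gcongr
    · rw [tendsto_iff_norm_sub_tendsto_zero]
      refine squeeze_zero (fun _ => norm_nonneg _) (fun n => ?_)
        (by simpa using hlim.const_mul (exp u.re))
      have h0 := (h (-n)).1
      have e : Complex.tanh (u + (-n : ℤ) * a) - -1
          = Complex.exp (u + (-n : ℤ) * a) * (Complex.cosh (u + (-n : ℤ) * a))⁻¹ := by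
        rw [← Complex.cosh_add_sinh, Complex.tanh_eq_sinh_div_cosh]; field_simp; ring
      rw [e, norm_mul, Complex.norm_exp]
      have h3 := (h (-n)).2
      have h4 : (u + ((-n : ℤ) : ℂ) * a).re ≤ u.re := by simp; positivity
      simp only [Int.cast_neg, Int.cast_natCast, abs_neg, Nat.abs_cast] at h3 h4 ⊢
      gcongr
  have shift : ∀ d : ℤ, HasSum (fun n : ℤ =>
      Complex.tanh (u + ((n + d + 1 : ℤ) : ℂ) * a) - Complex.tanh (u + ((n + d : ℤ) : ℂ) * a))
      2 := fun d => by
    have := (Equiv.addRight d).hasSum_iff.2 step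
    norm_num at this
    simpa [Function.comp_def] using this
  induction d using Int.induction_on with
  | zero => simp
  | succ d ih =>
    convert ih.add (shift d) using 1
    · ext n; rw [← add_assoc]; ring
    · push_cast; ring
  | pred d ih =>
    have e : (((-(d : ℤ) - 1 : ℤ)) : ℂ) = ((-(d : ℤ) : ℤ) : ℂ) - 1 := by push_cast; ring
    have := ih.sub (shift (-d - 1))
    rw [e, mul_sub, mul_one]
    refine this.congr_fun fun n => ?_
    rw [show n + (-(d : ℤ) - 1) + 1 = n + -(d : ℤ) by ring]; ring

/-! ### Quadratic relations between the lattice sums -/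

/-- The constant by which the square of `sechSum` differs from `sechSqSum`. -/
noncomputable def sechConst (a : ℝ) : ℂ := ∑' d : ℤ, 2 * (d : ℂ) * (Complex.sinh (d * a))⁻¹

lemma sinh_int_add_mul_ne_zero {b : ℝ} (hb : 0 < b) {n : ℤ} {s : ℝ} (h : (n : ℝ) + s ≠ 0) :
    Complex.sinh ((n + s) * b) ≠ 0 := by
  have := sinh_ofReal_ne_zero (mul_ne_zero h hb.ne')
  push_cast at this
  exact this

lemma sechSum_sq {a M : ℝ} {u : ℂ} (ha : 0 < a) (h : SechBound a M u) :
    sechSum a u ^ 2 = sechSqSum a u + sechConst a := by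
  set f : ℤ → ℂ := fun n => (Complex.cosh (u + n * a))⁻¹ with hf
  have hs : Summable f := h.summable ha
  have h1 : HasSum (fun z : ℤ × ℤ => f z.2 * f (z.2 + z.1)) (sechSum a u ^ 2) := by
    have := hasSum_mul_prod hs hs
    rw [← intShear.hasSum_iff, ← (Equiv.prodComm ℤ ℤ).hasSum_iff, ← sq] at this
    exact this
  have h2 := h1.prod_fiberwise (g := fun d : ℤ => (if d = 0 then sechSqSum a u else 0)
      + 2 * (d : ℂ) * (Complex.sinh (d * a))⁻¹) fun d => by
    by_cases hd : d = 0
    · subst hd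
      simpa [hf, sq, sechSqSum] using (h.summable_sq ha).hasSum
    · have hne : Complex.sinh (d * a) ≠ 0 := by
        have := sinh_int_add_mul_ne_zero ha (n := d) (s := 0) (by simpa using hd)
        simpa using this
      have := (hasSum_tanh_sub ha h d).mul_right (Complex.sinh (d * a))⁻¹
      simp only [hd, if_false, zero_add]
      refine this.congr_fun fun n => ?_
      rw [tanh_sub_tanh_eq (h _).1 (h _).1]
      have e : u + ((n + d : ℤ) : ℂ) * a - (u + n * a) = d * a := by push_cast; ring
      rw [e, mul_right_comm, mul_inv_cancel₀ hne, one_mul, mul_comm]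
  have h3 := h2.sub (hasSum_ite_eq (0 : ℤ) (sechSqSum a u))
  simp only [add_sub_cancel_left] at h3
  rw [sechConst, h3.tsum_eq]; ring

lemma SechBound.summable_tanh_sub {b M M' : ℝ} {u : ℂ} (hb : 0 < b) (h : SechBound b M u)
    (h' : SechBound b M' (u + b / 2)) (h'' : SechBound b M' (u - b / 2)) :
    Summable fun n : ℤ => (Complex.tanh (u + n * b) -
    (Complex.tanh (u + b / 2 + n * b) + Complex.tanh (u - b / 2 + n * b)) / 2) := by
  have hM := h.nonneg
  have hM' := h'.nonneg
  refine (((summable_exp_neg_mul_abs hb).mul_left M).mul_left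
    (‖Complex.sinh (b / 2)‖ * M')).of_norm_bounded fun n => ?_
  have e : Complex.tanh (u + n * b) -
      (Complex.tanh (u + b / 2 + n * b) + Complex.tanh (u - b / 2 + n * b)) / 2
      = (1 / 2) * (Complex.sinh (b / 2) * ((Complex.cosh (u + n * b))⁻¹ *
        ((Complex.cosh (u - b / 2 + n * b))⁻¹ - (Complex.cosh (u + b / 2 + n * b))⁻¹))) := by
    have e1 := tanh_sub_tanh_eq (h n).1 (h' n).1
    have e2 := tanh_sub_tanh_eq (h n).1 (h'' n).1
    rw [show u + n * b - (u + b / 2 + n * b) = -((b : ℂ) / 2) by ring, Complex.sinh_neg] at e1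
    rw [show u + n * b - (u - b / 2 + n * b) = (b : ℂ) / 2 by ring] at e2
    linear_combination (e1 + e2) / 2
  rw [e]
  simp only [norm_mul]
  have b1 := (h n).2
  have b2 := h'.norm_le hb n
  have b3 := h''.norm_le hb n
  have b4 := (norm_sub_le (Complex.cosh (u - b / 2 + n * b))⁻¹
    (Complex.cosh (u + b / 2 + n * b))⁻¹)
  have b5 : ‖(Complex.cosh (u - b / 2 + n * b))⁻¹ - (Complex.cosh (u + b / 2 + n * b))⁻¹‖
      ≤ 2 * M' := by linarith
  have b6 : ‖(1 / 2 : ℂ)‖ = 1 / 2 := by norm_num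
  rw [b6]
  calc _ ≤ 1 / 2 * (‖Complex.sinh (b / 2)‖ * (M * exp (-(b * |(n : ℝ)|)) * (2 * M'))) := by
        gcongr
    _ = _ := by ring

lemma tanhSum_mul_sechSum {b M M' : ℝ} {u : ℂ} (hb : 0 < b) (h : SechBound b M u)
    (h' : SechBound b M' (u + b / 2)) (h'' : SechBound b M' (u - b / 2)) :
    tanhSum b u * sechSum b u = tanhSechSum b u := by
  set f : ℤ → ℂ := fun n => (Complex.cosh (u + n * b))⁻¹ with hf
  set fp : ℤ → ℂ := fun n => (Complex.cosh (u + b / 2 + n * b))⁻¹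
  set fm : ℤ → ℂ := fun n => (Complex.cosh (u - b / 2 + n * b))⁻¹
  set g : ℝ → ℤ → ℂ := fun s n => (Complex.sinh ((n + s) * b))⁻¹ with hg
  set c : ℝ → ℤ → ℂ := fun s n => Complex.cosh ((n + s) * b) * g s n with hc
  set κ : ℤ → ℂ := fun n => -c 0 n + (c (-(1 / 2)) n + c (1 / 2) n) / 2 with hκ
  have hneg : ∀ (s : ℝ) (n : ℤ), ((((-n : ℤ) : ℂ)) + ((-s : ℝ) : ℂ)) * b = -((n + s) * b) :=
    fun s n => by push_cast; ring
  have gneg : ∀ s n, g (-s) (-n) = -g s n := fun s n => by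
    simp only [hg]
    rw [hneg, Complex.sinh_neg, inv_neg]
  have cneg : ∀ s n, c (-s) (-n) = -c s n := fun s n => by
    simp only [hc]
    rw [hneg, Complex.cosh_neg, gneg]; ring
  have hhalf : ∀ (n : ℤ), (n : ℝ) + 1 / 2 ≠ 0 := fun n hn => by
    have : (2 * n + 1 : ℤ) = 0 := by
      have : ((2 * n + 1 : ℤ) : ℝ) = 0 := by push_cast; linarith
      exact_mod_cast this
    omega
  have hhalf' : ∀ (n : ℤ), (n : ℝ) + (-(1 / 2) : ℝ) ≠ 0 := fun n hn => by
    refine hhalf (n - 1) ?_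
    push_cast; linarith
  have sg0 : ∑' n, g 0 n = 0 := tsum_eq_zero_of_odd (Equiv.neg ℤ) fun n => by
    simpa using gneg 0 n
  have sgm : ∑' n, g (-(1 / 2)) n = 0 :=
    tsum_eq_zero_of_odd (Equiv.subLeft (1 : ℤ)) fun n => by
      rw [← gneg]
      simp only [hg, Equiv.subLeft_apply]
      push_cast; ring_nf
  have sgp : ∑' n, g (1 / 2) n = 0 :=
    tsum_eq_zero_of_odd (Equiv.subLeft (-1 : ℤ)) fun n => by
      rw [← gneg]
      simp only [hg, Equiv.subLeft_apply]
      push_cast; ring_nf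
  have sκ : ∑' n, κ n = 0 := tsum_eq_zero_of_odd (Equiv.neg ℤ) fun n => by
    have e1 := cneg 0 n
    have e2 := cneg (1 / 2) n
    have e3 := cneg (-(1 / 2)) n
    rw [neg_zero] at e1
    rw [neg_neg] at e3
    simp only [hκ, Equiv.neg_apply, e1, e2, e3]; ring
  have κeq : ∀ n, κ n = Complex.sinh (b / 2) / 2 * (g 0 n * (g (-(1 / 2)) n - g (1 / 2) n)) := by
    intro n
    have n2 := sinh_int_add_mul_ne_zero hb (hhalf n)
    have n3 := sinh_int_add_mul_ne_zero hb (hhalf' n)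
    by_cases hn : n = 0
    · subst hn
      have := cneg (1 / 2) 0
      rw [neg_zero] at this
      simp only [hκ, this]
      simp [hc, hg]
    · have n1 := sinh_int_add_mul_ne_zero hb (n := n) (s := 0) (by simpa using hn)
      have e1 := coth_sub_coth_eq n2 n1
      have e2 := coth_sub_coth_eq n3 n1
      rw [show ((n : ℂ) + (0 : ℝ)) * b - (n + ((1 / 2 : ℝ) : ℂ)) * b = -((b : ℂ) / 2) by
        push_cast; ring, Complex.sinh_neg] at e1
      rw [show ((n : ℂ) + (0 : ℝ)) * b - (n + ((-(1 / 2) : ℝ) : ℂ)) * b = (b : ℂ) / 2 by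
        push_cast; ring] at e2
      simp only [hκ, hc, hg]
      linear_combination (e1 + e2) / 2
  have sumg : ∀ s : ℝ, s = 0 ∨ s = 1 / 2 ∨ s = -(1 / 2) → Summable (g s) := fun s hs =>
    summable_inv_sinh hb hs
  have sumκ : Summable κ := by
    have hC := cschConst_pos hb
    refine (((summable_exp_neg_mul_abs hb).mul_left (cschConst b)).mul_left
      (‖Complex.sinh (b / 2)‖ * cschConst b)).of_norm_bounded fun n => ?_
    have b1 : ‖g 0 n‖ ≤ _ := norm_inv_sinh_le hb (Or.inl rfl)
    have hle : cschConst b * exp (-(b * |(n : ℝ)|)) ≤ cschConst b := by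
      refine mul_le_of_le_one_right hC.le ?_
      rw [exp_le_one_iff]
      have : 0 ≤ b * |(n : ℝ)| := by positivity
      linarith
    have b2 : ‖g (1 / 2) n‖ ≤ _ := norm_inv_sinh_le hb (Or.inr (Or.inl rfl))
    have b3 : ‖g (-(1 / 2)) n‖ ≤ _ := norm_inv_sinh_le hb (Or.inr (Or.inr rfl))
    have b4 : ‖g (-(1 / 2)) n - g (1 / 2) n‖ ≤ 2 * cschConst b := by
      have := norm_sub_le (g (-(1 / 2)) n) (g (1 / 2) n)
      linarith
    rw [κeq, norm_mul, norm_mul, norm_div, Complex.norm_two]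
    calc _ ≤ ‖Complex.sinh (b / 2)‖ / 2 *
          (cschConst b * exp (-(b * |(n : ℝ)|)) * (2 * cschConst b)) := by gcongr
      _ = _ := by ring
  have sumf : Summable f := h.summable hb
  have H := ((((hasSum_mul_fst_sub sumf (sumg 0 (Or.inl rfl))).sub
    ((hasSum_mul_fst_sub (h'.summable hb) (sumg _ (Or.inr (Or.inr rfl)))).div_const 2)).sub
    ((hasSum_mul_fst_sub (h''.summable hb) (sumg _ (Or.inr (Or.inl rfl)))).div_const 2)).add
    (hasSum_mul_snd_sub sumf sumκ)).add (hasSum_diag (h.summable_tanh_mul hb))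
  rw [sg0, sgm, sgp, sκ] at H
  simp only [mul_zero, zero_div, sub_zero, zero_add] at H
  have H' := hasSum_mul_prod (h.summable_tanh_sub hb h' h'') sumf
  refine H'.unique (H.congr_fun fun z => ?_)
  obtain ⟨m, n⟩ := z
  have main : ∀ (s : ℝ) (p : ℂ), p = u - s * b + m * b → Complex.cosh p ≠ 0 →
      ((n - m : ℤ) : ℝ) + s ≠ 0 →
      Complex.tanh p * f n = (Complex.cosh p)⁻¹ * g s (n - m) - c s (n - m) * f n := by
    intro s p hp hp0 hs
    have hne := sinh_int_add_mul_ne_zero hb hs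
    have e : u + n * b - p = (((n - m : ℤ) : ℂ) + s) * b := by rw [hp]; push_cast; ring
    rw [← e] at hne
    have := tanh_mul_inv_cosh_eq hp0 (h n).1 hne
    rw [e] at this
    exact this
  have m1 := main (-(1 / 2)) (u + b / 2 + m * b) (by push_cast; ring) (h' m).1 (hhalf' _)
  have m2 := main (1 / 2) (u - b / 2 + m * b) (by push_cast; ring) (h'' m).1 (hhalf _)
  by_cases hmn : m = n
  · subst hmn
    have e0 : c 0 0 = 0 := by simp [hc, hg]
    have e1 : g 0 0 = 0 := by simp [hg]
    simp only [sub_self, if_true, hκ, e0, e1] at m1 m2 ⊢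
    linear_combination -(m1 + m2) / 2
  · have m0 := main 0 (u + m * b) (by push_cast; ring) (h m).1 (by
      simp only [add_zero, ne_eq, Int.cast_eq_zero]; omega)
    simp only [hmn, if_false, hκ]
    linear_combination m0 - (m1 + m2) / 2

namespace SechBound

variable {a M : ℝ} {u : ℂ}

lemma add_half (h : SechBound a M u) (ha : 0 < a) :
    SechBound (2 * a) (M * exp a) (u + ((2 * a : ℝ) : ℂ) / 2) := by
  have := (h.add_int_mul ha 1).two_mul
  have e : ((2 * a : ℝ) : ℂ) / 2 = ((1 : ℤ) : ℂ) * a := by push_cast; ring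
  rw [e]
  simpa using this

lemma sub_half (h : SechBound a M u) (ha : 0 < a) :
    SechBound (2 * a) (M * exp a) (u - ((2 * a : ℝ) : ℂ) / 2) := by
  have := (h.add_int_mul ha (-1)).two_mul
  have e : u - ((2 * a : ℝ) : ℂ) / 2 = u + ((-1 : ℤ) : ℂ) * a := by push_cast; ring
  rw [e]
  simpa using this

lemma add_self (h : SechBound a M u) (ha : 0 < a) : SechBound a (M * exp a) (u + a) := by
  have := h.add_int_mul ha 1
  simpa using this

end SechBound

lemma tanhSum_add_half {a M : ℝ} {u : ℂ} (ha : 0 < a) (h : SechBound a M u) :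
    tanhSum (2 * a) (u + a) = -tanhSum (2 * a) u := by
  have h2 : 0 < 2 * a := by positivity
  have s1 := h.two_mul.summable_tanh_sub h2 (h.add_half ha) (h.sub_half ha)
  have ha' := h.add_self ha
  have s2 := ha'.two_mul.summable_tanh_sub h2 (ha'.add_half ha) (ha'.sub_half ha)
  have t1 := hasSum_tanh_sub h2 h.two_mul 1
  have t2 := hasSum_tanh_sub h2 (h.sub_half ha) 1
  have H := (t2.sub t1).div_const 2
  rw [sub_self, zero_div] at H
  have H2 := s2.hasSum.add s1.hasSum
  rw [eq_neg_iff_add_eq_zero]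
  refine H2.unique (H.congr_fun fun n => ?_)
  have e1 : u + ((n + 1 : ℤ) : ℂ) * ((2 * a : ℝ) : ℂ)
    = u + a + ((2 * a : ℝ) : ℂ) / 2 + n * ((2 * a : ℝ) : ℂ) := by push_cast; ring
  have e2 : u - ((2 * a : ℝ) : ℂ) / 2 + ((n + 1 : ℤ) : ℂ) * ((2 * a : ℝ) : ℂ)
    = u + a + n * ((2 * a : ℝ) : ℂ) := by push_cast; ring
  have e3 : u + a + n * ((2 * a : ℝ) : ℂ)
    = u + ((2 * a : ℝ) : ℂ) / 2 + n * ((2 * a : ℝ) : ℂ) := by push_cast; ring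
  have e4 : u + a - ((2 * a : ℝ) : ℂ) / 2 + n * ((2 * a : ℝ) : ℂ)
    = u + n * ((2 * a : ℝ) : ℂ) := by push_cast; ring
  rw [e1, e2, e4, ← e3]
  ring

lemma tanhSum_mul_sechSum_two_mul {a M : ℝ} {u : ℂ} (ha : 0 < a) (h : SechBound a M u) :
    tanhSum (2 * a) u * sechSum (2 * a) u = tanhSechSum (2 * a) u :=
  tanhSum_mul_sechSum (by positivity) h.two_mul (h.add_half ha) (h.sub_half ha)

/-! ### Derivatives of the lattice sums along lines -/

section Line

variable {a M : ℝ} {p ω : ℂ} {S : Set ℝ}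

lemma hasDerivAt_line (p ω : ℂ) (t : ℝ) : HasDerivAt (fun t : ℝ => p + ω * t) ω t := by
  simpa using ((Complex.ofRealCLM.hasDerivAt (x := t)).const_mul ω).const_add p

lemma hasDerivAt_line_add (p ω c : ℂ) (t : ℝ) : HasDerivAt (fun t : ℝ => p + ω * t + c) ω t :=
  (hasDerivAt_line p ω t).add_const c

lemma hasDerivAt_sechSum (ha : 0 < a) (hS : IsOpen S) (hS' : IsPreconnected S)
    (h : ∀ t ∈ S, SechBound a M (p + ω * t)) {t : ℝ} (ht : t ∈ S) :
    HasDerivAt (fun t : ℝ => sechSum a (p + ω * t)) (-(ω * tanhSechSum a (p + ω * t))) t := by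
  have key := hasDerivAt_tsum_of_isPreconnected
    (((summable_exp_neg_mul_abs ha).mul_left M).mul_left ((1 + M) * ‖ω‖)) hS hS'
    (g := fun (n : ℤ) (t : ℝ) => (Complex.cosh (p + ω * t + n * a))⁻¹)
    (g' := fun (n : ℤ) (t : ℝ) => -(Complex.tanh (p + ω * t + n * a) *
      (Complex.cosh (p + ω * t + n * a))⁻¹) * ω)
    (fun n y hy => HasDerivAt.comp (h₂ := fun w => (Complex.cosh w)⁻¹) y
      (hasDerivAt_inv_cosh (h y hy n).1) (hasDerivAt_line_add p ω _ y))
    (fun n y hy => by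
      rw [norm_mul, norm_neg]
      calc _ ≤ (1 + M) * (M * exp (-(a * |(n : ℝ)|))) * ‖ω‖ := by
            gcongr; exact (h y hy).norm_tanh_mul_le ha n
        _ = _ := by ring)
    ht ((h t ht).summable ha) ht
  refine key.congr_deriv ?_
  rw [tsum_mul_right, tsum_neg, tanhSechSum]; ring

lemma hasDerivAt_tsum_tanh_sub (ha : 0 < a) (hS : IsOpen S) (hS' : IsPreconnected S)
    (h : ∀ t ∈ S, SechBound a M (p + ω * t)) {t : ℝ} (ht : t ∈ S) (h0 : 0 ∈ S) :
    HasDerivAt (fun t : ℝ => ∑' n : ℤ, (Complex.tanh (p + ω * t + n * a)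
      - Complex.tanh (p + n * a))) (ω * sechSqSum a (p + ω * t)) t := by
  have key := hasDerivAt_tsum_of_isPreconnected
    (((summable_exp_neg_mul_abs ha).mul_left M).mul_left (M * ‖ω‖)) hS hS'
    (g := fun (n : ℤ) (t : ℝ) => Complex.tanh (p + ω * t + n * a) - Complex.tanh (p + n * a))
    (g' := fun (n : ℤ) (t : ℝ) => (Complex.cosh (p + ω * t + n * a))⁻¹ ^ 2 * ω)
    (fun n y hy => ((hasDerivAt_tanh (h y hy n).1).comp y
      (hasDerivAt_line_add p ω _ y)).sub_const _)
    (fun n y hy => by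
      rw [norm_mul]
      calc _ ≤ M * (M * exp (-(a * |(n : ℝ)|))) * ‖ω‖ := by
            gcongr; exact (h y hy).norm_sq_le ha n
        _ = _ := by ring)
    h0 (by simp [summable_zero]) ht
  refine key.congr_deriv ?_
  rw [tsum_mul_right, sechSqSum]; ring

lemma hasDerivAt_tanhSum (ha : 0 < a) (hS : IsOpen S) (hS' : IsPreconnected S)
    (h : ∀ t ∈ S, SechBound a M (p + ω * t)) {t : ℝ} (ht : t ∈ S) :
    HasDerivAt (fun t : ℝ => tanhSum (2 * a) (p + ω * t))
      (ω * (sechSqSum (2 * a) (p + ω * t) - sechSqSum (2 * a) (p + ω * t + a))) t := by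
  have h2 : 0 < 2 * a := by positivity
  have hM := (h t ht).nonneg
  have key := hasDerivAt_tsum_of_isPreconnected
    (((summable_exp_neg_mul_abs h2).mul_left (M * exp a)).mul_left
      ((2 * (M * exp a)) * ‖ω‖)) hS hS'
    (g := fun (n : ℤ) (t : ℝ) => (Complex.tanh (p + ω * t + n * ((2 * a : ℝ) : ℂ)) -
    (Complex.tanh (p + ω * t + ((2 * a : ℝ) : ℂ) / 2 + n * ((2 * a : ℝ) : ℂ))
      + Complex.tanh (p + ω * t - ((2 * a : ℝ) : ℂ) / 2 + n * ((2 * a : ℝ) : ℂ))) / 2))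
    (g' := fun (n : ℤ) (t : ℝ) => (Complex.cosh (p + ω * t + n * ((2 * a : ℝ) : ℂ)))⁻¹ ^ 2 * ω -
      ((Complex.cosh (p + ω * t + ((2 * a : ℝ) : ℂ) / 2 + n * ((2 * a : ℝ) : ℂ)))⁻¹ ^ 2 * ω +
      (Complex.cosh (p + ω * t - ((2 * a : ℝ) : ℂ) / 2 + n * ((2 * a : ℝ) : ℂ)))⁻¹ ^ 2 * ω) / 2)
    (fun n y hy => by
      refine ((hasDerivAt_tanh ((h y hy).two_mul n).1).comp y (hasDerivAt_line_add p ω _ y)).sub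
        (((((hasDerivAt_tanh ((h y hy).add_half ha n).1).comp y
          ((hasDerivAt_line_add p ω _ y).add_const _))).add
        ((hasDerivAt_tanh ((h y hy).sub_half ha n).1).comp y
          (((hasDerivAt_line p ω y).sub_const _).add_const _))).div_const 2))
    (fun n y hy => by
      have b1 := ((h y hy).two_mul.mono (M' := M * exp a)
        (le_mul_of_one_le_right hM (one_le_exp ha.le))).norm_sq_le h2 n
      have b2 := ((h y hy).add_half ha).norm_sq_le h2 n
      have b3 := ((h y hy).sub_half ha).norm_sq_le h2 n
      refine (norm_sub_le _ _).trans ?_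
      rw [norm_div, Complex.norm_two]
      have b4 := norm_add_le
        ((Complex.cosh (p + ω * y + ((2 * a : ℝ) : ℂ) / 2 + n * ((2 * a : ℝ) : ℂ)))⁻¹ ^ 2 * ω)
        ((Complex.cosh (p + ω * y - ((2 * a : ℝ) : ℂ) / 2 + n * ((2 * a : ℝ) : ℂ)))⁻¹ ^ 2 * ω)
      simp only [norm_mul _ ω] at b4 ⊢
      have c1 := mul_le_mul_of_nonneg_right b1 (norm_nonneg ω)
      have c2 := mul_le_mul_of_nonneg_right b2 (norm_nonneg ω)
      have c3 := mul_le_mul_of_nonneg_right b3 (norm_nonneg ω)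
      linarith)
    ht ((h t ht).two_mul.summable_tanh_sub h2 ((h t ht).add_half ha) ((h t ht).sub_half ha)) ht
  refine key.congr_deriv ?_
  have s1 := ((h t ht).two_mul.summable_sq h2).mul_right ω
  have s2 := (((h t ht).add_half ha).summable_sq h2).mul_right ω
  have s3 := (((h t ht).sub_half ha).summable_sq h2).mul_right ω
  rw [s1.tsum_sub ((s2.add s3).div_const 2), tsum_div_const, s2.tsum_add s3, tsum_mul_right,
    tsum_mul_right, tsum_mul_right]
  have e1 : p + ω * t + a = p + ω * t + ((2 * a : ℝ) : ℂ) / 2 := by push_cast; ring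
  have e2 : sechSqSum (2 * a) (p + ω * t + ((2 * a : ℝ) : ℂ) / 2)
      = sechSqSum (2 * a) (p + ω * t - ((2 * a : ℝ) : ℂ) / 2) := by
    rw [← sechSqSum_add_period (2 * a) (p + ω * t - ((2 * a : ℝ) : ℂ) / 2)]
    congr 1; ring
  rw [e1]
  unfold sechSqSum at e2 ⊢
  rw [← e2]; ring

/-- Along a line on which `sech` has no poles, the half-lattice sums of `sech` and the alternating
sum of `tanh` satisfy a closed system of differential equations. -/
lemma lattice_system (ha : 0 < a) (hS : IsOpen S) (hS' : IsPreconnected S)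
    (h : ∀ t ∈ S, SechBound a M (p + ω * t)) {t : ℝ} (ht : t ∈ S) :
    HasDerivAt (fun t : ℝ => sechSum (2 * a) (p + ω * t))
      (-(ω * (tanhSum (2 * a) (p + ω * t) * sechSum (2 * a) (p + ω * t)))) t ∧
    HasDerivAt (fun t : ℝ => sechSum (2 * a) (p + ω * t + a))
      (ω * (tanhSum (2 * a) (p + ω * t) * sechSum (2 * a) (p + ω * t + a))) t ∧
    HasDerivAt (fun t : ℝ => tanhSum (2 * a) (p + ω * t))
      (ω * (sechSum (2 * a) (p + ω * t) ^ 2 - sechSum (2 * a) (p + ω * t + a) ^ 2)) t := by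
  have h2 : 0 < 2 * a := by positivity
  refine ⟨?_, ?_, ?_⟩
  · rw [tanhSum_mul_sechSum_two_mul ha (h t ht)]
    exact hasDerivAt_sechSum h2 hS hS' (fun t ht => (h t ht).two_mul) ht
  · have e : ∀ t : ℝ, p + ω * t + a = p + a + ω * t := fun t => by ring
    have := tanhSum_mul_sechSum_two_mul ha ((h t ht).add_self ha)
    rw [tanhSum_add_half ha (h t ht)] at this
    simp only [e] at this ⊢
    have h3 := hasDerivAt_sechSum (p := p + a) (ω := ω) (M := M * exp a) h2 hS hS'
      (fun t ht => by rw [← e]; exact ((h t ht).add_self ha).two_mul) ht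
    refine h3.congr_deriv ?_
    rw [← this]; ring
  · have e1 := sechSum_sq h2 (h t ht).two_mul
    have e2 := sechSum_sq h2 ((h t ht).add_self ha).two_mul
    refine (hasDerivAt_tanhSum ha hS hS' h ht).congr_deriv ?_
    rw [e1, e2]; ring

end Line

/-! ### Elliptic integrals -/

lemma image_sin_Ioo : sin '' Set.Ioo 0 (π / 2) = Set.Ioo 0 1 := by
  ext y
  constructor
  · rintro ⟨x, hx, rfl⟩
    refine ⟨sin_pos_of_pos_of_lt_pi hx.1 (by linarith [hx.2, pi_pos]), ?_⟩
    rw [← sin_pi_div_two]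
    exact sin_lt_sin_of_lt_of_le_pi_div_two (by linarith [hx.1, pi_pos]) le_rfl hx.2
  · rintro ⟨h0, h1⟩
    exact ⟨arcsin y, ⟨arcsin_pos.2 h0, arcsin_lt_pi_div_two.2 h1⟩,
      sin_arcsin (by linarith) h1.le⟩

lemma integral_sin_subst (f : ℝ → ℝ) :
    ∫ t in (0 : ℝ)..1, f t = ∫ θ in (0 : ℝ)..(π / 2), cos θ * f (sin θ) := by
  have hinj : Set.InjOn sin (Set.Ioo 0 (π / 2)) := injOn_sin.mono <| by
    rintro x ⟨h0, h1⟩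
    exact ⟨by linarith [pi_pos], h1.le⟩
  rw [intervalIntegral.integral_of_le zero_le_one,
    intervalIntegral.integral_of_le (by positivity),
    MeasureTheory.integral_Ioc_eq_integral_Ioo, MeasureTheory.integral_Ioc_eq_integral_Ioo,
    ← image_sin_Ioo, MeasureTheory.integral_image_eq_integral_abs_deriv_smul measurableSet_Ioo
      (fun x _ => (hasDerivAt_sin x).hasDerivWithinAt)
      hinj]
  refine MeasureTheory.setIntegral_congr_fun measurableSet_Ioo fun x hx => ?_
  have : 0 < cos x := cos_pos_of_mem_Ioo ⟨by linarith [hx.1, pi_pos], hx.2⟩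
  simp only [abs_of_pos this, smul_eq_mul]

lemma integral_congr_Ioo_pi_div_two {f g : ℝ → ℝ}
    (h : ∀ θ ∈ Set.Ioo 0 (π / 2), f θ = g θ) :
    ∫ θ in (0 : ℝ)..(π / 2), f θ = ∫ θ in (0 : ℝ)..(π / 2), g θ := by
  rw [intervalIntegral.integral_of_le (by positivity),
    intervalIntegral.integral_of_le (by positivity),
    MeasureTheory.integral_Ioc_eq_integral_Ioo, MeasureTheory.integral_Ioc_eq_integral_Ioo]
  exact MeasureTheory.setIntegral_congr_fun measurableSet_Ioo h

lemma ellipticK_eq (k : ℝ) :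
    ellipticK k = ∫ θ in (0 : ℝ)..(π / 2), 1 / √(1 - k ^ 2 * sin θ ^ 2) := by
  rw [ellipticK, integral_sin_subst]
  refine integral_congr_Ioo_pi_div_two fun x hx => ?_
  have : 0 < cos x := cos_pos_of_mem_Ioo ⟨by linarith [hx.1, pi_pos], hx.2⟩
  rw [← cos_sq', sqrt_mul (sq_nonneg _), sqrt_sq this.le]
  field_simp

lemma ellipticE_eq (k : ℝ) :
    ellipticE k = ∫ θ in (0 : ℝ)..(π / 2), √(1 - k ^ 2 * sin θ ^ 2) := by
  rw [ellipticE, integral_sin_subst]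
  refine integral_congr_Ioo_pi_div_two fun x hx => ?_
  have : 0 < cos x := cos_pos_of_mem_Ioo ⟨by linarith [hx.1, pi_pos], hx.2⟩
  rw [← cos_sq', sqrt_div' _ (sq_nonneg _), sqrt_sq this.le]
  field_simp

lemma integral_comp_cos_eq (f : ℝ → ℝ) :
    ∫ θ in (0 : ℝ)..(π / 2), f (cos θ) = ∫ θ in (0 : ℝ)..(π / 2), f (sin θ) := by
  have := intervalIntegral.integral_comp_sub_left (fun θ => f (cos θ)) (a := 0) (b := π / 2) (π / 2)
  simp only [sub_self, sub_zero, cos_pi_div_two_sub] at this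
  exact this.symm

lemma one_sub_sq_mul_sin_sq_pos {k : ℝ} (hk : k ^ 2 < 1) (θ : ℝ) :
    0 < 1 - k ^ 2 * sin θ ^ 2 := by
  nlinarith [sin_sq_le_one θ, sq_nonneg k]

lemma continuous_ellipticK_integrand {k : ℝ} (hk : k ^ 2 < 1) :
    Continuous fun θ => 1 / √(1 - k ^ 2 * sin θ ^ 2) :=
  continuous_const.div (by fun_prop) fun θ => (sqrt_pos.2 (one_sub_sq_mul_sin_sq_pos hk θ)).ne'

lemma ellipticK_pos {k : ℝ} (hk : k ^ 2 < 1) : 0 < ellipticK k := by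
  rw [ellipticK_eq]
  refine intervalIntegral.intervalIntegral_pos_of_pos
    ((continuous_ellipticK_integrand hk).intervalIntegrable _ _) (fun θ => ?_) (by positivity)
  have := sqrt_pos.2 (one_sub_sq_mul_sin_sq_pos hk θ)
  positivity

lemma ellipticK_lt {k l : ℝ} (hk : 0 ≤ k) (hkl : k < l) (hl : l < 1) :
    ellipticK k < ellipticK l := by
  have hl2 : l ^ 2 < 1 := by nlinarith
  have hkl2 : k ^ 2 < l ^ 2 := by nlinarith
  have hk2 : k ^ 2 < 1 := hkl2.trans hl2
  rw [ellipticK_eq, ellipticK_eq]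
  refine intervalIntegral.integral_lt_integral_of_continuousOn_of_le_of_exists_lt (by positivity)
    (continuous_ellipticK_integrand hk2).continuousOn
    (continuous_ellipticK_integrand hl2).continuousOn (fun θ _ => ?_)
    ⟨π / 2, ⟨by positivity, le_rfl⟩, ?_⟩
  · have := sqrt_pos.2 (one_sub_sq_mul_sin_sq_pos hl2 θ)
    gcongr
  · have := sqrt_pos.2 (one_sub_sq_mul_sin_sq_pos hl2 (π / 2))
    simp only [sin_pi_div_two] at this ⊢
    refine one_div_lt_one_div_of_lt this (sqrt_lt_sqrt ?_ ?_) <;> nlinarith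

lemma xRatio_injOn : Set.InjOn xRatio (Set.Ioo 0 1) := by
  have anti : StrictAntiOn xRatio (Set.Ioo 0 1) := fun k hk l hl hkl => by
    obtain ⟨hk0, hk1⟩ := hk
    obtain ⟨hl0, hl1⟩ := hl
    have h1 : √(1 - l ^ 2) < √(1 - k ^ 2) := sqrt_lt_sqrt (by nlinarith) (by nlinarith)
    have h2 : √(1 - k ^ 2) < 1 := by rw [sqrt_lt' one_pos]; nlinarith
    have h3 := ellipticK_lt (sqrt_nonneg _) h1 h2
    have h4 := ellipticK_lt hk0.le hkl hl1
    have h5 := ellipticK_pos (k := k) (by nlinarith)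
    have h6 := ellipticK_pos (k := √(1 - l ^ 2)) (by rw [sq_sqrt] <;> nlinarith)
    unfold xRatio
    exact div_lt_div₀ h3 h4.le (h6.trans h3).le h5
  exact anti.injOn

lemma integral_one_div_sqrt {A B : ℝ} (hB : 0 < B) :
    ∫ θ in (0 : ℝ)..(π / 2), 1 / √(B ^ 2 - A ^ 2 * sin θ ^ 2) = ellipticK (A / B) / B := by
  rw [ellipticK_eq, ← intervalIntegral.integral_div]
  refine intervalIntegral.integral_congr fun θ _ => ?_
  have : B ^ 2 - A ^ 2 * sin θ ^ 2 = B ^ 2 * (1 - (A / B) ^ 2 * sin θ ^ 2) := by field_simp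
  rw [this, sqrt_mul (sq_nonneg _), sqrt_sq hB.le, div_div, mul_comm B]

lemma integral_sqrt_sub {A B : ℝ} (hB : 0 < B) :
    ∫ θ in (0 : ℝ)..(π / 2), √(B ^ 2 - A ^ 2 * sin θ ^ 2) = B * ellipticE (A / B) := by
  rw [ellipticE_eq, ← intervalIntegral.integral_const_mul]
  refine intervalIntegral.integral_congr fun θ _ => ?_
  have : B ^ 2 - A ^ 2 * sin θ ^ 2 = B ^ 2 * (1 - (A / B) ^ 2 * sin θ ^ 2) := by field_simp
  rw [this, sqrt_mul (sq_nonneg _), sqrt_sq hB.le]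

/-! ### Solving the differential equations -/

lemma eq_of_hasDerivAt_zero {f : ℝ → ℝ} {L : ℝ} (h : ∀ t ∈ Set.Icc 0 L, HasDerivAt f 0 t) :
    ∀ t ∈ Set.Icc 0 L, f t = f 0 :=
  constant_of_has_deriv_right_zero (fun t ht => (h t ht).continuousAt.continuousWithinAt)
    fun t ht => (h t ⟨ht.1, ht.2.le⟩).hasDerivWithinAt

lemma integral_comp_of_deriv_eq {θ g h : ℝ → ℝ} {L : ℝ} (hL : 0 ≤ L)
    (hθ : ∀ t ∈ Set.Icc 0 L, HasDerivAt θ (g (θ t)) t) (hg : Continuous g) (hg0 : ∀ x, g x ≠ 0)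
    (hh : Continuous h) :
    ∫ t in (0 : ℝ)..L, h (θ t) = ∫ x in θ 0..θ L, h x / g x := by
  rw [← intervalIntegral.integral_comp_mul_deriv (f := θ) (f' := fun t => g (θ t))
    (g := fun x => h x / g x)]
  · refine intervalIntegral.integral_congr fun t _ => ?_
    simp only [Function.comp]
    rw [div_mul_cancel₀ _ (hg0 _)]
  · rwa [Set.uIcc_of_le hL]
  · rw [Set.uIcc_of_le hL]
    exact hg.comp_continuousOn fun t ht => (hθ t ht).continuousAt.continuousWithinAt
  · exact hh.div hg hg0

/-- A solution of the rotation system at angle `θ`. -/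
lemma rotation_system {X Y D θ : ℝ → ℝ} {L : ℝ}
    (hX : ∀ t ∈ Set.Icc 0 L, HasDerivAt X (-(Y t * D t)) t)
    (hY : ∀ t ∈ Set.Icc 0 L, HasDerivAt Y (X t * D t) t)
    (hθ : ∀ t ∈ Set.Icc 0 L, HasDerivAt θ (D t) t) (hY0 : Y 0 = 0) (hθ0 : θ 0 = 0) :
    ∀ t ∈ Set.Icc 0 L, X t = X 0 * cos (θ t) ∧ Y t = X 0 * sin (θ t) := by
  intro t ht
  have h1 := eq_of_hasDerivAt_zero (f := fun t => X t * cos (θ t) + Y t * sin (θ t)) (fun t ht => by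
    refine (((hX t ht).mul (hθ t ht).cos).add ((hY t ht).mul (hθ t ht).sin)).congr_deriv ?_
    ring) t ht
  have h2 := eq_of_hasDerivAt_zero (f := fun t => Y t * cos (θ t) - X t * sin (θ t)) (fun t ht => by
    refine (((hY t ht).mul (hθ t ht).cos).sub ((hX t ht).mul (hθ t ht).sin)).congr_deriv ?_
    ring) t ht
  simp only [hY0, hθ0, cos_zero, sin_zero] at h1 h2
  have h3 := sin_sq_add_cos_sq (θ t)
  constructor
  · linear_combination cos (θ t) * h1 - sin (θ t) * h2 - X t * h3
  · linear_combination sin (θ t) * h1 + cos (θ t) * h2 - Y t * h3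

lemma real_line_solution {θ C T D : ℝ → ℝ} {L : ℝ} (hL : 0 ≤ L)
    (hθ : ∀ t ∈ Set.Icc 0 L, HasDerivAt θ (D t) t)
    (hC : ∀ t ∈ Set.Icc 0 L, HasDerivAt C (-(T t * D t)) t)
    (hT : ∀ t ∈ Set.Icc 0 L, HasDerivAt T (C t * D t) t)
    (hD : ∀ t ∈ Set.Icc 0 L, HasDerivAt D (-(T t * C t)) t)
    (hθ0 : θ 0 = 0) (hθL : θ L = π / 2) (hT0 : T 0 = 0) (hpos : ∀ t ∈ Set.Icc 0 L, 0 < D t) :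
    T L = C 0 ∧ D L ^ 2 = D 0 ^ 2 - C 0 ^ 2 ∧ L * D 0 = ellipticK (C 0 / D 0) := by
  have h0 : (0 : ℝ) ∈ Set.Icc 0 L := ⟨le_rfl, hL⟩
  have hLL : L ∈ Set.Icc 0 L := ⟨hL, le_rfl⟩
  have hB := hpos 0 h0
  have hrot := rotation_system hC hT hθ hT0 hθ0
  have hcons : ∀ t ∈ Set.Icc 0 L, T t ^ 2 + D t ^ 2 = D 0 ^ 2 := fun t ht => by
    have := eq_of_hasDerivAt_zero (f := fun t => T t ^ 2 + D t ^ 2) (fun t ht => by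
      refine (((hT t ht).pow 2).add ((hD t ht).pow 2)).congr_deriv ?_
      push_cast; ring) t ht
    simpa [hT0] using this
  have hTL : T L = C 0 := by
    rw [(hrot L hLL).2, hθL, sin_pi_div_two, mul_one]
  have hDL : D L ^ 2 = D 0 ^ 2 - C 0 ^ 2 := by
    have := hcons L hLL
    rw [hTL] at this; linarith
  have hlt : 0 < D 0 ^ 2 - C 0 ^ 2 := hDL ▸ pow_pos (hpos L hLL) 2
  refine ⟨hTL, hDL, ?_⟩
  have hpos' : ∀ x, 0 < D 0 ^ 2 - C 0 ^ 2 * sin x ^ 2 := fun x => by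
    nlinarith [sin_sq_le_one x, sq_nonneg (C 0)]
  have hDeq : ∀ t ∈ Set.Icc 0 L, D t = √(D 0 ^ 2 - C 0 ^ 2 * sin (θ t) ^ 2) := fun t ht => by
    rw [← hcons t ht, (hrot t ht).2, mul_pow, add_sub_cancel_left, sqrt_sq (hpos t ht).le]
  have key := integral_comp_of_deriv_eq (h := fun _ => 1)
    (g := fun x => √(D 0 ^ 2 - C 0 ^ 2 * sin x ^ 2)) hL
    (fun t ht => hDeq t ht ▸ hθ t ht) (by fun_prop) (fun x => (sqrt_pos.2 (hpos' x)).ne')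
    continuous_const
  rw [hθ0, hθL, integral_one_div_sqrt hB] at key
  simp only [intervalIntegral.integral_const, sub_zero, smul_eq_mul, mul_one] at key
  rw [key]; field_simp

lemma vertical_line_ne_zero {T Γ D : ℝ → ℝ} {L : ℝ} (hL : 0 ≤ L)
    (hD : ∀ t, HasDerivAt D (-(Γ t * T t)) t) (hΓ : ∀ t, HasDerivAt Γ (D t * T t) t)
    (hT : ∀ t, HasDerivAt T (Γ t * D t) t) (hΓ0 : Γ 0 = 0) (hD0 : 0 < D 0) (hDL : D L = 0) :
    T 0 ≠ 0 := by
  intro hT0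
  have hDc : Continuous D := continuous_iff_continuousAt.2 fun t => (hD t).continuousAt
  set δ : ℝ → ℝ := fun t => ∫ s in (0 : ℝ)..t, D s with hδ
  have hδ' : ∀ t, HasDerivAt δ (D t) t := fun t =>
    (hDc.integral_hasStrictDerivAt 0 t).hasDerivAt
  have h1 : ∀ t ∈ Set.Icc 0 L, T t + Γ t = 0 := fun t ht => by
    have := eq_of_hasDerivAt_zero (f := fun t => (T t + Γ t) * exp (-δ t)) (fun t _ => by
      refine (((hT t).add (hΓ t)).mul (hδ' t).neg.exp).congr_deriv ?_
      simp only [Pi.add_apply]; ring) t ht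
    simpa [hT0, hΓ0, (exp_pos _).ne'] using this
  have h2 : ∀ t ∈ Set.Icc 0 L, T t - Γ t = 0 := fun t ht => by
    have := eq_of_hasDerivAt_zero (f := fun t => (T t - Γ t) * exp (δ t)) (fun t _ => by
      refine (((hT t).sub (hΓ t)).mul (hδ' t).exp).congr_deriv ?_
      simp only [Pi.sub_apply]; ring) t ht
    simpa [hT0, hΓ0, (exp_pos _).ne'] using this
  have h3 := eq_of_hasDerivAt_zero (f := D) (L := L) (fun t ht => by
    refine (hD t).congr_deriv ?_
    have : T t = 0 := by linarith [h1 t ht, h2 t ht]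
    rw [this]; ring) L ⟨hL, le_rfl⟩
  linarith

lemma vertical_line_solution {T Γ D : ℝ → ℝ} {L : ℝ} (hLpos : 0 < L)
    (hD : ∀ t, HasDerivAt D (-(Γ t * T t)) t) (hΓ : ∀ t, HasDerivAt Γ (D t * T t) t)
    (hT : ∀ t, HasDerivAt T (Γ t * D t) t) (hΓ0 : Γ 0 = 0) (hDL : D L = 0)
    (hpos : ∀ t ∈ Set.Ico 0 L, 0 < D t) (hT0 : 0 < T 0) {B : ℝ} (hB : 0 < B)
    (hB2 : B ^ 2 = T 0 ^ 2 + D 0 ^ 2) :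
    L * B = ellipticK (D 0 / B) ∧
      ∫ t in (0 : ℝ)..L, D t ^ 2 = B * (ellipticK (D 0 / B) - ellipticE (D 0 / B)) := by
  have hL := hLpos.le
  have hTc : Continuous T := continuous_iff_continuousAt.2 fun t => (hT t).continuousAt
  set ψ : ℝ → ℝ := fun t => ∫ s in (0 : ℝ)..t, T s with hψ
  have hψ' : ∀ t, HasDerivAt ψ (T t) t := fun t =>
    (hTc.integral_hasStrictDerivAt 0 t).hasDerivAt
  have hψ0 : ψ 0 = 0 := by simp [hψ]
  have hrot := rotation_system (L := L) (fun t _ => hD t) (fun t _ => hΓ t) (fun t _ => hψ' t)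
    hΓ0 hψ0
  have hcons : ∀ t ∈ Set.Icc 0 L, T t ^ 2 + D t ^ 2 = B ^ 2 := fun t ht => by
    have := eq_of_hasDerivAt_zero (f := fun t => T t ^ 2 + D t ^ 2) (fun t ht => by
      refine (((hT t).pow 2).add ((hD t).pow 2)).congr_deriv ?_
      push_cast; ring) t ht
    rw [hB2]; exact this
  have hpos' : ∀ x, 0 < B ^ 2 - D 0 ^ 2 * cos x ^ 2 := fun x => by
    nlinarith [cos_sq_le_one x, sq_nonneg (D 0)]
  have hTne : ∀ t ∈ Set.Icc 0 L, T t ≠ 0 := fun t ht h => by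
    have h1 := hcons t ht
    rw [h, (hrot t ht).1] at h1
    have := hpos' (ψ t)
    nlinarith
  have hTpos : ∀ t ∈ Set.Icc 0 L, 0 < T t := fun t ht => by
    by_contra! hneg
    obtain ⟨s, hs, hs0⟩ := intermediate_value_Icc' ht.1 hTc.continuousOn ⟨hneg, hT0.le⟩
    exact hTne s ⟨hs.1, hs.2.trans ht.2⟩ hs0
  have hψc : Continuous ψ := continuous_iff_continuousAt.2 fun t => (hψ' t).continuousAt
  have hψL : ψ L = π / 2 := by
    have h1 : 0 < ψ L := intervalIntegral.intervalIntegral_pos_of_pos_on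
      (hTc.intervalIntegrable _ _) (fun t ht => hTpos t ⟨ht.1.le, ht.2.le⟩) hLpos
    have hD0 := hpos 0 ⟨le_rfl, hLpos⟩
    have h2 : cos (ψ L) = 0 := by
      have := (hrot L ⟨hL, le_rfl⟩).1
      rw [hDL] at this
      simpa [hD0.ne'] using this.symm
    rcases lt_trichotomy (ψ L) (π / 2) with h | h | h
    · exact absurd h2 (cos_pos_of_mem_Ioo ⟨by linarith [pi_pos], h⟩).ne'
    · exact h
    · obtain ⟨s, hs, hs0⟩ := intermediate_value_Icc hL hψc.continuousOn
        (show π / 2 ∈ Set.Icc (ψ 0) (ψ L) from ⟨by rw [hψ0]; positivity, h.le⟩)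
      have hsL : s < L := lt_of_le_of_ne hs.2 fun e => by rw [e] at hs0; linarith
      have h3 := hpos s ⟨hs.1, hsL⟩
      rw [(hrot s hs).1, hs0, cos_pi_div_two, mul_zero] at h3
      exact absurd h3 (lt_irrefl _)
  have hTeq : ∀ t ∈ Set.Icc 0 L, T t = √(B ^ 2 - D 0 ^ 2 * cos (ψ t) ^ 2) := fun t ht => by
    rw [← hcons t ht, (hrot t ht).1, mul_pow, add_sub_cancel_right, sqrt_sq (hTpos t ht).le]
  have key : ∀ h : ℝ → ℝ, Continuous h → ∫ t in (0 : ℝ)..L, h (ψ t)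
      = ∫ x in (0 : ℝ)..(π / 2), h x / √(B ^ 2 - D 0 ^ 2 * cos x ^ 2) := fun h hh => by
    have := integral_comp_of_deriv_eq (h := h)
      (g := fun x => √(B ^ 2 - D 0 ^ 2 * cos x ^ 2)) hL
      (fun t ht => hTeq t ht ▸ hψ' t) (by fun_prop) (fun x => (sqrt_pos.2 (hpos' x)).ne') hh
    rwa [hψ0, hψL] at this
  have hK : ∫ x in (0 : ℝ)..(π / 2), 1 / √(B ^ 2 - D 0 ^ 2 * cos x ^ 2)
      = ellipticK (D 0 / B) / B := by
    rw [integral_comp_cos_eq fun y => 1 / √(B ^ 2 - D 0 ^ 2 * y ^ 2), integral_one_div_sqrt hB]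
  have hE : ∫ x in (0 : ℝ)..(π / 2), √(B ^ 2 - D 0 ^ 2 * cos x ^ 2)
      = B * ellipticE (D 0 / B) := by
    rw [integral_comp_cos_eq fun y => √(B ^ 2 - D 0 ^ 2 * y ^ 2), integral_sqrt_sub hB]
  constructor
  · have h1 := key (fun _ => 1) continuous_const
    rw [hK] at h1
    simp only [intervalIntegral.integral_const, sub_zero, smul_eq_mul, mul_one] at h1
    rw [h1]; field_simp
  · have h1 := key (fun x => D 0 ^ 2 * cos x ^ 2) (by fun_prop)
    have h2 : ∫ t in (0 : ℝ)..L, D t ^ 2 = ∫ t in (0 : ℝ)..L, D 0 ^ 2 * cos (ψ t) ^ 2 :=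
      intervalIntegral.integral_congr fun t ht => by
        rw [Set.uIcc_of_le hL] at ht
        simp only [(hrot t ht).1, mul_pow]
    have hc1 : Continuous fun x => B ^ 2 * (1 / √(B ^ 2 - D 0 ^ 2 * cos x ^ 2)) :=
      continuous_const.mul
        (continuous_const.div (by fun_prop) fun x => (sqrt_pos.2 (hpos' x)).ne')
    have hc2 : Continuous fun x => √(B ^ 2 - D 0 ^ 2 * cos x ^ 2) := by fun_prop
    have h3 : ∫ x in (0 : ℝ)..(π / 2), D 0 ^ 2 * cos x ^ 2 / √(B ^ 2 - D 0 ^ 2 * cos x ^ 2)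
        = ∫ x in (0 : ℝ)..(π / 2), (B ^ 2 * (1 / √(B ^ 2 - D 0 ^ 2 * cos x ^ 2))
          - √(B ^ 2 - D 0 ^ 2 * cos x ^ 2)) :=
      intervalIntegral.integral_congr fun x _ => by
        have p := sqrt_pos.2 (hpos' x)
        have q := sq_sqrt (hpos' x).le
        field_simp
        linarith
    rw [h2, h1, h3, intervalIntegral.integral_sub (hc1.intervalIntegrable _ _)
      (hc2.intervalIntegrable _ _), intervalIntegral.integral_const_mul, hK, hE]
    field_simp

/-! ### The lattice sums on the real line and on a vertical line -/

lemma cosh_add_mul_I (x y : ℝ) :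
    Complex.cosh (x + Complex.I * y) = (cosh x * cos y : ℝ) + (sinh x * sin y : ℝ) * Complex.I := by
  rw [mul_comm, Complex.cosh_add, Complex.cosh_mul_I, Complex.sinh_mul_I]
  push_cast; ring

lemma normSq_cosh_add_mul_I (x y : ℝ) :
    Complex.normSq (Complex.cosh (x + Complex.I * y)) = sinh x ^ 2 + cos y ^ 2 := by
  rw [cosh_add_mul_I, Complex.normSq_add_mul_I]
  have := cosh_sq x
  have := sin_sq y
  rw [mul_pow, mul_pow, cosh_sq x, sin_sq y]; ring

lemma re_inv_cosh_add_mul_I (x y : ℝ) :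
    (Complex.cosh (x + Complex.I * y))⁻¹.re = cosh x * cos y / (sinh x ^ 2 + cos y ^ 2) := by
  rw [Complex.inv_re, normSq_cosh_add_mul_I, cosh_add_mul_I]
  simp [Complex.cos_ofReal_re]

lemma sechBound_ofReal {a R t : ℝ} (ht : |t| ≤ R) : SechBound a (2 * exp R) (t : ℂ) := by
  intro n
  have e : ((t : ℂ) + n * a) = ((t + n * a : ℝ) : ℂ) := by push_cast; ring
  rw [e, ← Complex.ofReal_cosh]
  have hpos := cosh_pos (t + n * a)
  refine ⟨by exact_mod_cast hpos.ne', ?_⟩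
  rw [norm_inv, Complex.norm_real, norm_of_nonneg hpos.le, inv_le_comm₀ hpos (by positivity),
    mul_assoc, ← exp_add, mul_inv, ← exp_neg]
  have h1 : exp |t + n * a| ≤ 2 * cosh (t + n * a) := by
    rw [← cosh_abs, cosh_eq]
    have := exp_pos (-|t + n * a|)
    linarith
  have h2 : a * |(n : ℝ)| ≤ |t + n * a| + R := by
    have := abs_sub (t + n * a) t
    rw [add_sub_cancel_left, abs_mul] at this
    have := le_abs_self a
    have := abs_nonneg (n : ℝ)
    nlinarith
  have h3 : exp (-(R + -(a * |(n : ℝ)|))) ≤ exp |t + n * a| := by gcongr; linarith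
  linarith

lemma sechBound_half_add_mul_I {a : ℝ} (ha : 0 < a) (v : ℝ) :
    SechBound a (cschConst a) (((a / 2 : ℝ) : ℂ) + Complex.I * v) := by
  intro n
  have e : ((a / 2 : ℝ) : ℂ) + Complex.I * v + n * a
      = (((n + 1 / 2) * a : ℝ) : ℂ) + Complex.I * v := by push_cast; ring
  rw [e]
  have hn : ((n : ℝ) + 1 / 2) * a ≠ 0 := by
    refine mul_ne_zero (fun hn => ?_) ha.ne'
    have : ((2 * n + 1 : ℤ) : ℝ) = 0 := by push_cast; linarith
    have : (2 * n + 1 : ℤ) = 0 := by exact_mod_cast this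
    omega
  have hs : 0 < |sinh ((n + 1 / 2) * a)| := abs_pos.2 (sinh_ne_zero.2 hn)
  have hle : |sinh ((n + 1 / 2) * a)|
      ≤ ‖Complex.cosh ((((n + 1 / 2) * a : ℝ) : ℂ) + Complex.I * v)‖ := by
    refine abs_le_of_sq_le_sq' ?_ (norm_nonneg _) |> abs_le.2
    rw [← Complex.normSq_eq_norm_sq, normSq_cosh_add_mul_I]
    nlinarith [sq_nonneg (cos v)]
  refine ⟨fun h0 => ?_, ?_⟩
  · rw [h0, norm_zero] at hle
    linarith
  · rw [norm_inv]
    exact (inv_anti₀ hs hle).trans (inv_abs_sinh_le ha (Or.inr (Or.inl rfl)))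

lemma re_sechSum_pos {a M x y : ℝ} (ha : 0 < a) (h : SechBound a M (x + Complex.I * y))
    (hy : 0 < cos y) : 0 < (sechSum a (x + Complex.I * y)).re := by
  have hs := h.summable ha
  have e : ∀ n : ℤ, (Complex.cosh (x + Complex.I * y + n * a))⁻¹.re
      = cosh (x + n * a) * cos y / (sinh (x + n * a) ^ 2 + cos y ^ 2) := fun n => by
    rw [← re_inv_cosh_add_mul_I]
    push_cast; ring_nf
  rw [sechSum, Complex.re_tsum hs]
  have hpos : ∀ n : ℤ, 0 < (Complex.cosh (x + Complex.I * y + n * a))⁻¹.re := fun n => by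
    rw [e]
    have := cosh_pos (x + n * a)
    positivity
  exact (Complex.hasSum_re hs.hasSum).summable.tsum_pos (fun n => (hpos n).le) 0 (hpos 0)

lemma im_sechSum_ofReal (a t : ℝ) : (sechSum a (t : ℂ)).im = 0 := by
  have := sechSum_conj a t
  rw [Complex.conj_ofReal] at this
  exact Complex.conj_eq_iff_im.1 this.symm

lemma im_tanhSum_ofReal (b t : ℝ) : (tanhSum b (t : ℂ)).im = 0 := by
  have := tanhSum_conj b t
  rw [Complex.conj_ofReal] at this
  exact Complex.conj_eq_iff_im.1 this.symm

lemma HasDerivAt.re_comp {f : ℝ → ℂ} {f' : ℂ} {t : ℝ} (h : HasDerivAt f f' t) :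
    HasDerivAt (fun t => (f t).re) f'.re t :=
  Complex.reCLM.hasFDerivAt.comp_hasDerivAt t h

lemma HasDerivAt.im_comp {f : ℝ → ℂ} {f' : ℂ} {t : ℝ} (h : HasDerivAt f f' t) :
    HasDerivAt (fun t => (f t).im) f'.im t :=
  Complex.imCLM.hasFDerivAt.comp_hasDerivAt t h

/-- The sum of the Gudermannian function over a lattice. -/
noncomputable def gdSum (a t : ℝ) : ℝ :=
  ∑' n : ℤ, (arctan (sinh (t + n * a)) - arctan (sinh (n * a)))

lemma summable_gdSum_and_hasDerivAt {a R t : ℝ} (ha : 0 < a) (ht : |t| < R) :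
    (Summable fun n : ℤ => arctan (sinh (t + n * a)) - arctan (sinh (n * a))) ∧
      HasDerivAt (gdSum a) (sechSum a t).re t := by
  have hR : 0 < R := (abs_nonneg t).trans_lt ht
  have hb : ∀ (n : ℤ), ∀ y ∈ Set.Ioo (-R) R,
      ‖(cosh (y + n * a))⁻¹‖ ≤ 2 * exp R * exp (-(a * |(n : ℝ)|)) := fun n y hy => by
    have := (sechBound_ofReal (a := a) (abs_lt.2 hy).le n).2
    have e : ((y : ℂ) + n * a) = ((y + n * a : ℝ) : ℂ) := by push_cast; ring
    rw [e, ← Complex.ofReal_cosh, norm_inv, Complex.norm_real] at this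
    rwa [norm_inv]
  have hd : ∀ (n : ℤ), ∀ y ∈ Set.Ioo (-R) R,
      HasDerivAt (fun t => arctan (sinh (t + n * a)) - arctan (sinh (n * a)))
        (cosh (y + n * a))⁻¹ y := fun n y _ => by
    have h1 : HasDerivAt (fun t : ℝ => t + n * a) 1 y := (hasDerivAt_id y).add_const _
    refine (h1.sinh.arctan.sub_const _).congr_deriv ?_
    have := cosh_pos (y + n * a)
    rw [add_comm 1, ← cosh_sq]
    field_simp
  have hu := (summable_exp_neg_mul_abs ha).mul_left (2 * exp R)
  have h0 : (0 : ℝ) ∈ Set.Ioo (-R) R := ⟨by linarith, hR⟩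
  have ht' : t ∈ Set.Ioo (-R) R := abs_lt.1 ht
  have hs0 : Summable fun n : ℤ => arctan (sinh (0 + n * a)) - arctan (sinh (n * a)) := by
    simp_rw [zero_add, sub_self]
    exact summable_zero
  set g : ℤ → ℝ → ℝ := fun n t => arctan (sinh (t + n * a)) - arctan (sinh (n * a))
  refine ⟨summable_of_summable_hasDerivAt_of_isPreconnected (g := g) hu isOpen_Ioo
    isPreconnected_Ioo hd hb h0 hs0 ht', (hasDerivAt_tsum_of_isPreconnected (g := g) hu isOpen_Ioo
    isPreconnected_Ioo hd hb h0 hs0 ht').congr_deriv ?_⟩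
  rw [sechSum, Complex.re_tsum ((sechBound_ofReal ht.le).summable ha)]
  refine tsum_congr fun n => ?_
  have e : ((t : ℂ) + n * a) = ((t + n * a : ℝ) : ℂ) := by push_cast; ring
  rw [e, ← Complex.ofReal_cosh, ← Complex.ofReal_inv, Complex.ofReal_re]

lemma tendsto_sinh_atTop : Tendsto sinh atTop atTop := by
  refine tendsto_atTop_mono' _ ?_ tendsto_id
  filter_upwards [eventually_ge_atTop 0] with x hx using self_le_sinh_iff.2 hx

lemma gdSum_half {a : ℝ} (ha : 0 < a) : gdSum a (a / 2) = π / 2 := by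
  have hs := (summable_gdSum_and_hasDerivAt (t := a / 2) (R := a) ha
    (by rw [abs_of_pos] <;> linarith)).1
  have h1 := hs.hasSum
  have h2 := (Equiv.subLeft (-1 : ℤ)).hasSum_iff.2 h1
  have h3 := h1.add h2
  have hlim : Tendsto (fun n : ℕ => arctan (sinh ((n : ℤ) * a))) atTop (𝓝 (π / 2)) := by
    refine (tendsto_nhds_of_tendsto_nhdsWithin tendsto_arctan_atTop).comp
      (tendsto_sinh_atTop.comp ?_)
    simpa using tendsto_natCast_atTop_atTop.atTop_mul_const ha
  have hlim' : Tendsto (fun n : ℕ => arctan (sinh ((-(n : ℤ) : ℤ) * a))) atTop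
      (𝓝 (-(π / 2))) := by
    refine hlim.neg.congr fun n => ?_
    push_cast
    rw [neg_mul, sinh_neg, arctan_neg]
  have hfun : ∀ n : ℤ, (arctan (sinh ((n + 1 : ℤ) * a)) - arctan (sinh (n * a)))
      = (arctan (sinh (a / 2 + n * a)) - arctan (sinh (n * a))) +
      (arctan (sinh (a / 2 + (Equiv.subLeft (-1 : ℤ) n : ℤ) * a))
        - arctan (sinh ((Equiv.subLeft (-1 : ℤ) n : ℤ) * a))) := fun n => by
    have e1 : a / 2 + ((Equiv.subLeft (-1 : ℤ) n : ℤ) : ℝ) * a = -(a / 2 + n * a) := by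
      simp only [Equiv.subLeft_apply]; push_cast; ring
    have e2 : ((Equiv.subLeft (-1 : ℤ) n : ℤ) : ℝ) * a = -((n + 1 : ℤ) * a) := by
      simp only [Equiv.subLeft_apply]; push_cast; ring
    rw [e1, e2, sinh_neg, sinh_neg, arctan_neg, arctan_neg]; ring
  have h4 := h3.congr_fun (g := fun n : ℤ =>
    (arctan (sinh ((n + 1 : ℤ) * a)) - arctan (sinh (n * a)))) hfun
  have h5 := (hasSum_sub_of_tendsto (f := fun n : ℤ => arctan (sinh (n * a))) h4.summable
    hlim hlim').unique h4
  rw [gdSum]; linarith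

lemma real_line_evaluation {a : ℝ} (ha : 0 < a) :
    ∃ A : ℝ, (tanhSum (2 * a) ((a / 2 : ℝ) : ℂ)).re = A ∧
      (sechSum a ((a / 2 : ℝ) : ℂ)).re ^ 2 = (sechSum a (0 : ℝ)).re ^ 2 - A ^ 2 ∧
      a / 2 * (sechSum a (0 : ℝ)).re = ellipticK (A / (sechSum a (0 : ℝ)).re) := by
  have hmem : ∀ t ∈ Set.Icc 0 (a / 2), t ∈ Set.Ioo (-a) a := fun t ht =>
    ⟨by linarith [ht.1], by linarith [ht.2]⟩
  have hbd : ∀ t ∈ Set.Ioo (-a) a, SechBound a (2 * exp a) ((0 : ℂ) + 1 * (t : ℂ)) :=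
    fun t ht => by
      rw [zero_add, one_mul]
      exact sechBound_ofReal (abs_lt.2 ht).le
  have hsys := fun t ht => lattice_system ha isOpen_Ioo isPreconnected_Ioo hbd (t := t) (hmem t ht)
  simp only [zero_add, one_mul] at hsys hbd
  have hsplit : ∀ t ∈ Set.Icc 0 (a / 2), (sechSum a (t : ℂ)).re
      = (sechSum (2 * a) (t : ℂ)).re + (sechSum (2 * a) (t + a : ℂ)).re := fun t ht => by
    rw [sechSum_two_mul ha (hbd t (hmem t ht)), Complex.add_re]
  have im1 : ∀ t : ℝ, (sechSum (2 * a) (t : ℂ)).im = 0 := im_sechSum_ofReal _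
  have im2 : ∀ t : ℝ, (sechSum (2 * a) (t + a : ℂ)).im = 0 := fun t => by
    simpa using im_sechSum_ofReal (2 * a) (t + a)
  have im3 : ∀ t : ℝ, (tanhSum (2 * a) (t : ℂ)).im = 0 := im_tanhSum_ofReal _
  have hF := fun t ht => (hsys t ht).1.re_comp
  have hG := fun t ht => (hsys t ht).2.1.re_comp
  have hT := fun t ht => (hsys t ht).2.2.re_comp
  simp only [sq, Complex.neg_re, Complex.sub_re, Complex.mul_re, im1, im2, im3, mul_zero,
    sub_zero] at hF hG hT
  have h0 : (0 : ℝ) ∈ Set.Icc 0 (a / 2) := ⟨le_rfl, by linarith⟩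
  have hL : a / 2 ∈ Set.Icc 0 (a / 2) := ⟨by linarith, le_rfl⟩
  have hpos : ∀ t : ℝ, 0 < (sechSum a (t : ℂ)).re := fun t => by
    have := re_sechSum_pos (x := t) (y := 0) (M := 2 * exp |t|) ha
      (by simpa using sechBound_ofReal (le_refl |t|)) (by simp)
    simpa using this
  have key := real_line_solution (L := a / 2) (θ := gdSum a)
    (C := fun t => (sechSum (2 * a) (t : ℂ)).re - (sechSum (2 * a) (t + a : ℂ)).re)
    (T := fun t => (tanhSum (2 * a) (t : ℂ)).re)
    (D := fun t => (sechSum (2 * a) (t : ℂ)).re + (sechSum (2 * a) (t + a : ℂ)).re)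
    (by linarith)
    (fun t ht => by
      rw [← hsplit t ht]
      exact (summable_gdSum_and_hasDerivAt ha (abs_lt.2 (hmem t ht))).2)
    (fun t ht => ((hF t ht).sub (hG t ht)).congr_deriv (by ring))
    (fun t ht => (hT t ht).congr_deriv (by ring))
    (fun t ht => ((hF t ht).add (hG t ht)).congr_deriv (by ring))
    (by simp [gdSum]) (gdSum_half ha)
    (by
      have := tanhSum_neg (2 * a) 0
      rw [neg_zero, self_eq_neg] at this
      simp [this])
    (fun t ht => by rw [← hsplit t ht]; exact hpos t)
  simp only [← hsplit _ hL, ← hsplit _ h0] at key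
  exact ⟨_, key⟩

lemma sechSum_half_add_conj (a v : ℝ) :
    sechSum (2 * a) (((a / 2 : ℝ) : ℂ) + Complex.I * v + a)
      = starRingEnd ℂ (sechSum (2 * a) (((a / 2 : ℝ) : ℂ) + Complex.I * v)) := by
  rw [← sechSum_conj, ← sechSum_neg, ← sechSum_add_period]
  congr 1
  simp only [map_add, map_mul, Complex.conj_I, Complex.conj_ofReal]
  push_cast; ring

lemma im_tanhSum_half {a : ℝ} (ha : 0 < a) (v : ℝ) :
    (tanhSum (2 * a) (((a / 2 : ℝ) : ℂ) + Complex.I * v)).im = 0 := by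
  have h : SechBound a (cschConst a * exp a) (((a / 2 : ℝ) : ℂ) + Complex.I * v - a) := by
    simpa [sub_eq_add_neg] using (sechBound_half_add_mul_I ha v).add_int_mul ha (-1)
  have h1 := tanhSum_add_half ha h
  rw [sub_add_cancel, ← tanhSum_neg] at h1
  rw [← Complex.conj_eq_iff_im, ← tanhSum_conj, h1]
  congr 1
  simp only [map_add, map_mul, Complex.conj_I, Complex.conj_ofReal]
  push_cast; ring

lemma sechSum_half_add_mul_I {a : ℝ} (ha : 0 < a) (v : ℝ) :
    sechSum a (((a / 2 : ℝ) : ℂ) + Complex.I * v)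
      = ((2 * (sechSum (2 * a) (((a / 2 : ℝ) : ℂ) + Complex.I * v)).re : ℝ) : ℂ) := by
  rw [sechSum_two_mul ha (sechBound_half_add_mul_I ha v), sechSum_half_add_conj, Complex.add_conj]

lemma half_lattice_add (a v : ℝ) (n : ℤ) : ((a / 2 : ℝ) : ℂ) + Complex.I * v + n * a
    = (((n + 1 / 2) * a : ℝ) : ℂ) + Complex.I * v := by push_cast; ring

lemma half_lattice_pi_div_two (a : ℝ) (n : ℤ) :
    ((a / 2 : ℝ) : ℂ) + Complex.I * ((π / 2 : ℝ) : ℂ) + n * a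
      = (((n + 1 / 2) * a : ℝ) : ℂ) + π / 2 * Complex.I := by push_cast; ring

lemma cosh_add_pi_div_two_mul_I (z : ℂ) :
    Complex.cosh (z + π / 2 * Complex.I) = Complex.sinh z * Complex.I := by
  rw [Complex.cosh_add, Complex.cosh_mul_I, Complex.sinh_mul_I, Complex.cos_pi_div_two,
    Complex.sin_pi_div_two]; ring

lemma sinh_add_pi_div_two_mul_I (z : ℂ) :
    Complex.sinh (z + π / 2 * Complex.I) = Complex.cosh z * Complex.I := by
  rw [Complex.sinh_add, Complex.cosh_mul_I, Complex.sinh_mul_I, Complex.cos_pi_div_two,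
    Complex.sin_pi_div_two]; ring

lemma sechSum_half_add_pi_div_two {a : ℝ} (ha : 0 < a) :
    (sechSum a (((a / 2 : ℝ) : ℂ) + Complex.I * ((π / 2 : ℝ) : ℂ))).re = 0 := by
  rw [sechSum, Complex.re_tsum ((sechBound_half_add_mul_I ha _).summable ha)]
  refine (tsum_congr fun n => ?_).trans tsum_zero
  rw [half_lattice_add, re_inv_cosh_add_mul_I, cos_pi_div_two]
  simp

lemma tsum_tanh_sub_half_pi_div_two (a : ℝ) :
    ∑' n : ℤ, (Complex.tanh (((a / 2 : ℝ) : ℂ) + Complex.I * ((π / 2 : ℝ) : ℂ) + n * a)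
      - Complex.tanh (((a / 2 : ℝ) : ℂ) + n * a)) = 0 := by
  refine tsum_eq_zero_of_odd (Equiv.subLeft (-1 : ℤ)) fun n => ?_
  have e : ((((Equiv.subLeft (-1 : ℤ) n : ℤ) : ℝ) + 1 / 2) * a : ℝ) = -((n + 1 / 2) * a) := by
    simp only [Equiv.subLeft_apply]; push_cast; ring
  have e2 : ∀ n : ℤ, ((a / 2 : ℝ) : ℂ) + n * a = (((n + 1 / 2) * a : ℝ) : ℂ) := fun n => by
    push_cast; ring
  rw [half_lattice_pi_div_two, half_lattice_pi_div_two, e2, e2, e]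
  simp only [Complex.tanh_eq_sinh_div_cosh, cosh_add_pi_div_two_mul_I, sinh_add_pi_div_two_mul_I,
    Complex.ofReal_neg, Complex.sinh_neg, Complex.cosh_neg]
  ring

lemma integral_sechSum_sq {a : ℝ} (ha : 0 < a) :
    ∫ v in (0 : ℝ)..(π / 2), (sechSum a (((a / 2 : ℝ) : ℂ) + Complex.I * v)).re ^ 2
      = π / 2 * (sechConst a).re := by
  have hN := fun v : ℝ => (hasDerivAt_tsum_tanh_sub (p := ((a / 2 : ℝ) : ℂ)) (ω := Complex.I)
    ha isOpen_univ isPreconnected_univ (fun t _ => sechBound_half_add_mul_I ha t)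
    (Set.mem_univ v) (Set.mem_univ 0)).im_comp
  have hder : ∀ v : ℝ, (Complex.I * sechSqSum a (((a / 2 : ℝ) : ℂ) + Complex.I * v)).im
      = (sechSum a (((a / 2 : ℝ) : ℂ) + Complex.I * v)).re ^ 2 - (sechConst a).re := fun v => by
    have h := sechSum_sq ha (sechBound_half_add_mul_I ha v)
    have h1 : sechSqSum a (((a / 2 : ℝ) : ℂ) + Complex.I * v)
      = sechSum a (((a / 2 : ℝ) : ℂ) + Complex.I * v) ^ 2 - sechConst a := by rw [h]; ring
    rw [h1, Complex.I_mul_im, Complex.sub_re, sechSum_half_add_mul_I ha v, ← Complex.ofReal_pow,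
      Complex.ofReal_re, Complex.ofReal_re]
  simp only [hder] at hN
  have hcont : Continuous fun v : ℝ =>
      (sechSum a (((a / 2 : ℝ) : ℂ) + Complex.I * v)).re :=
    continuous_iff_continuousAt.2 fun v =>
      (hasDerivAt_sechSum (p := ((a / 2 : ℝ) : ℂ)) (ω := Complex.I)
        ha isOpen_univ isPreconnected_univ (fun t _ => sechBound_half_add_mul_I ha t)
        (Set.mem_univ v)).re_comp.continuousAt
  have hsq : Continuous fun v : ℝ =>
      (sechSum a (((a / 2 : ℝ) : ℂ) + Complex.I * v)).re ^ 2 := hcont.pow 2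
  have hint := intervalIntegral.integral_eq_sub_of_hasDerivAt (a := 0) (b := π / 2)
    (fun v _ => hN v)
    ((hsq.sub continuous_const).intervalIntegrable _ _)
  rw [tsum_tanh_sub_half_pi_div_two, intervalIntegral.integral_sub
    (hsq.intervalIntegrable _ _) intervalIntegrable_const] at hint
  simp [-Complex.ofReal_div] at hint
  linarith

lemma vertical_line_evaluation {a B : ℝ} (ha : 0 < a) (hB : 0 < B)
    (hB2 : (sechSum a ((a / 2 : ℝ) : ℂ)).re ^ 2
      = B ^ 2 - (tanhSum (2 * a) ((a / 2 : ℝ) : ℂ)).re ^ 2) :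
    0 < (sechSum a ((a / 2 : ℝ) : ℂ)).re ∧ (sechSum a ((a / 2 : ℝ) : ℂ)).re < B ∧
    π / 2 * B = ellipticK ((sechSum a ((a / 2 : ℝ) : ℂ)).re / B) ∧
      π / 2 * (sechConst a).re = B * (ellipticK ((sechSum a ((a / 2 : ℝ) : ℂ)).re / B)
        - ellipticE ((sechSum a ((a / 2 : ℝ) : ℂ)).re / B)) := by
  have hsys := fun v : ℝ => lattice_system (p := ((a / 2 : ℝ) : ℂ)) (ω := Complex.I)
    ha isOpen_univ isPreconnected_univ (fun t _ => sechBound_half_add_mul_I ha t) (Set.mem_univ v)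
  have imT := im_tanhSum_half ha
  have hX := fun v => (hsys v).1.re_comp
  have hY := fun v => (hsys v).1.im_comp
  have hT := fun v => (hsys v).2.2.re_comp
  simp only [sechSum_half_add_conj, sq, Complex.neg_re, Complex.neg_im, Complex.sub_im,
    Complex.sub_re, Complex.mul_re, Complex.mul_im, Complex.I_re, Complex.I_im, Complex.conj_re,
    Complex.conj_im, imT, zero_mul, one_mul, zero_add, add_zero, zero_sub,
    sub_zero] at hX hY hT
  have hre : ∀ v : ℝ, (sechSum a (((a / 2 : ℝ) : ℂ) + Complex.I * v)).re
      = 2 * (sechSum (2 * a) (((a / 2 : ℝ) : ℂ) + Complex.I * v)).re := fun v => by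
    rw [sechSum_half_add_mul_I ha v, Complex.ofReal_re]
  have e0 : ((a / 2 : ℝ) : ℂ) + Complex.I * ((0 : ℝ) : ℂ) = ((a / 2 : ℝ) : ℂ) := by simp
  have hpos : ∀ v ∈ Set.Ico 0 (π / 2),
      0 < (sechSum a (((a / 2 : ℝ) : ℂ) + Complex.I * v)).re := fun v hv =>
    re_sechSum_pos ha (sechBound_half_add_mul_I ha v)
      (cos_pos_of_mem_Ioo ⟨by linarith [hv.1, pi_pos], hv.2⟩)
  have hint := integral_sechSum_sq ha
  set D : ℝ → ℝ := fun v => (sechSum a (((a / 2 : ℝ) : ℂ) + Complex.I * v)).re with hD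
  set T : ℝ → ℝ := fun v => (tanhSum (2 * a) (((a / 2 : ℝ) : ℂ) + Complex.I * v)).re with hTd
  set Γ : ℝ → ℝ := fun v =>
    -(2 * (sechSum (2 * a) (((a / 2 : ℝ) : ℂ) + Complex.I * v)).im) with hΓ
  have dD : ∀ v, HasDerivAt D (-(Γ v * T v)) v := fun v => by
    simp only [hD, hre]
    refine ((hX v).const_mul 2).congr_deriv ?_
    simp only [hΓ, hTd]; ring
  have dΓ : ∀ v, HasDerivAt Γ (D v * T v) v := fun v => by
    refine ((hY v).const_mul 2).neg.congr_deriv ?_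
    simp only [hD, hre, hTd]; ring
  have dT : ∀ v, HasDerivAt T (Γ v * D v) v := fun v => by
    refine (hT v).congr_deriv ?_
    simp only [hD, hre, hΓ]; ring
  have hΓ0 : Γ 0 = 0 := by
    simp only [hΓ, e0, im_sechSum_ofReal, mul_zero, neg_zero]
  have hDL : D (π / 2) = 0 := sechSum_half_add_pi_div_two ha
  have hL : 0 < π / 2 := by positivity
  have D0 : D 0 = (sechSum a ((a / 2 : ℝ) : ℂ)).re := by simp only [hD, e0]
  have T0 : T 0 = (tanhSum (2 * a) ((a / 2 : ℝ) : ℂ)).re := by simp only [hTd, e0]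
  rw [← D0, ← T0] at hB2
  rw [← D0]
  have hD0 : 0 < D 0 := hpos 0 ⟨le_rfl, hL⟩
  have hT0 := vertical_line_ne_zero hL.le dD dΓ dT hΓ0 hD0 hDL
  have hmain : π / 2 * B = ellipticK (D 0 / B) ∧
      ∫ t in (0 : ℝ)..(π / 2), D t ^ 2 = B * (ellipticK (D 0 / B) - ellipticE (D 0 / B)) := by
    rcases lt_or_gt_of_ne hT0 with h | h
    · refine vertical_line_solution (T := fun v => -T v) (Γ := fun v => -Γ v) hL
        (fun v => (dD v).congr_deriv (by ring)) (fun v => (dΓ v).neg.congr_deriv (by ring))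
        (fun v => (dT v).neg.congr_deriv (by ring)) (by simp [hΓ0]) hDL hpos (by linarith) hB
        (by rw [neg_sq]; linarith)
    · exact vertical_line_solution hL dD dΓ dT hΓ0 hDL hpos h hB (by linarith)
  refine ⟨hD0, ?_, hmain.1, ?_⟩
  · have := sq_pos_of_ne_zero hT0
    exact lt_of_pow_lt_pow_left₀ 2 hB.le (by linarith)
  · rw [← hint, ← hmain.2]

/-! ### Evaluation of the hyperbolic sums -/

lemma one_div_sinh_sq_sub_one_div_cosh_sq {y : ℝ} (hy : y ≠ 0) :
    1 / sinh y ^ 2 - 1 / cosh y ^ 2 = 4 * (1 / sinh (2 * y) ^ 2) := by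
  have h1 := sinh_ne_zero.2 hy
  have h2 := (cosh_pos y).ne'
  rw [sinh_two_mul]
  field_simp
  rw [cosh_sq]; ring

lemma hasSum_nat_of_reflect {f : ℤ → ℝ} {s : ℝ} (h : HasSum f s) (hf : ∀ n, f (-n - 1) = f n) :
    HasSum (fun n : ℕ => f n) (s / 2) := by
  have hs : Summable fun n : ℕ => f n := h.summable.comp_injective Nat.cast_injective
  have h1 := hs.hasSum.of_nat_of_neg_add_one (f := f) (hs.hasSum.congr_fun fun n => by
    rw [← hf n]; congr 1; ring)
  rw [h.unique h1, add_self_div_two]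
  exact hs.hasSum

lemma hasSum_nat_of_even {f : ℤ → ℝ} {s : ℝ} (h : HasSum f s) (hf : ∀ n, f (-n) = f n) :
    HasSum (fun n : ℕ => f (n + 1)) ((s - f 0) / 2) := by
  have hs : Summable fun n : ℕ => f n := h.summable.comp_injective Nat.cast_injective
  have h2 : HasSum (fun n : ℕ => f (n + 1)) ((∑' n : ℕ, f n) - f 0) := by
    have := (hasSum_nat_add_iff' (f := fun n : ℕ => f n) 1).2 hs.hasSum
    simpa using this
  have h1 := hs.hasSum.of_nat_of_neg_add_one (f := f) (h2.congr_fun fun n => hf _)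
  rw [h.unique h1]
  convert h2 using 1
  ring

lemma hasSum_sechSqSum_ofReal {a M : ℝ} {u : ℂ} (ha : 0 < a) (h : SechBound a M u) {f : ℤ → ℝ}
    (hf : ∀ n : ℤ, (Complex.cosh (u + n * a))⁻¹ ^ 2 = f n) : HasSum f (sechSqSum a u).re := by
  have := Complex.hasSum_re (h.summable_sq ha).hasSum
  exact this.congr_fun fun n => by rw [hf, Complex.ofReal_re]

lemma hasSum_sech_sq {a : ℝ} (ha : 0 < a) :
    HasSum (fun n : ℕ => 1 / cosh ((n + 1) * a) ^ 2)
      (((sechSum a (0 : ℝ)).re ^ 2 - (sechConst a).re - 1) / 2) := by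
  have hb := sechBound_ofReal (a := a) (t := 0) (R := 0) (by simp)
  have h := hasSum_sechSqSum_ofReal ha hb (f := fun n : ℤ => 1 / cosh (n * a) ^ 2)
    fun n => by simp
  have e := congrArg Complex.re (sechSum_sq ha hb)
  rw [sq, Complex.mul_re, im_sechSum_ofReal, Complex.add_re] at e
  have := hasSum_nat_of_even h fun n => by simp [neg_mul, cosh_neg]
  convert this using 2
  · push_cast; rfl
  · simp only [Int.cast_zero, zero_mul, cosh_zero]; linarith

lemma hasSum_sech_half_sq {a : ℝ} (ha : 0 < a) :
    HasSum (fun n : ℕ => 1 / cosh ((n + 1 / 2) * a) ^ 2)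
      (((sechSum a ((a / 2 : ℝ) : ℂ)).re ^ 2 - (sechConst a).re) / 2) := by
  have hb := sechBound_ofReal (a := a) (t := a / 2) (R := |a / 2|) le_rfl
  have h := hasSum_sechSqSum_ofReal ha hb (f := fun n : ℤ => 1 / cosh ((n + 1 / 2) * a) ^ 2)
    fun n => by
      rw [show ((a / 2 : ℝ) : ℂ) + n * a = (((n + 1 / 2) * a : ℝ) : ℂ) by push_cast; ring]
      push_cast; ring
  have e := congrArg Complex.re (sechSum_sq ha hb)
  rw [sq, Complex.mul_re, im_sechSum_ofReal, Complex.add_re] at e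
  have := hasSum_nat_of_reflect h fun n => by
    rw [← cosh_neg]; push_cast; ring_nf
  simp only [Int.cast_natCast] at this
  convert this using 1
  linarith

lemma hasSum_csch_half_sq {a : ℝ} (ha : 0 < a) :
    HasSum (fun n : ℕ => 1 / sinh ((n + 1 / 2) * a) ^ 2) ((sechConst a).re / 2) := by
  have hb := sechBound_half_add_mul_I ha (π / 2)
  have h := hasSum_sechSqSum_ofReal ha hb (f := fun n : ℤ => -(1 / sinh ((n + 1 / 2) * a) ^ 2))
    fun n => by
      rw [half_lattice_pi_div_two, cosh_add_pi_div_two_mul_I, inv_pow, mul_pow, Complex.I_sq]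
      push_cast; ring
  have e := congrArg Complex.re (sechSum_sq ha hb)
  have h0 := sechSum_half_add_pi_div_two ha
  have e0 : sechSum a (((a / 2 : ℝ) : ℂ) + Complex.I * ((π / 2 : ℝ) : ℂ)) = 0 := by
    rw [sechSum_half_add_mul_I ha, Complex.ofReal_re] at h0
    rw [sechSum_half_add_mul_I ha, h0, Complex.ofReal_zero]
  rw [e0, zero_pow two_ne_zero, Complex.add_re, Complex.zero_re] at e
  generalize (sechSqSum a _).re = s at e h
  have := (hasSum_nat_of_reflect h fun n => by
    rw [← neg_sq (sinh _), ← sinh_neg]; push_cast; ring_nf).neg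
  simp only [neg_neg, Int.cast_natCast] at this
  rwa [show (sechConst a).re / 2 = -(s / 2) by linarith]

lemma hasSum_csch_sq {a b c d : ℝ} (ha : 0 < a)
    (hb : HasSum (fun n : ℕ => 1 / sinh ((n + 1 / 2) * a) ^ 2) b)
    (hc : HasSum (fun n : ℕ => 1 / cosh ((n + 1) * a) ^ 2) c)
    (hd : HasSum (fun n : ℕ => 1 / cosh ((n + 1 / 2) * a) ^ 2) d) :
    HasSum (fun n : ℕ => 1 / sinh ((n + 1) * a) ^ 2) ((b - c - d) / 3) := by
  have hs : Summable fun n : ℕ => 1 / sinh ((n + 1) * a) ^ 2 := by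
    refine hb.summable.of_nonneg_of_le (fun n => by positivity) fun n => ?_
    have : 0 < sinh ((n + 1 / 2) * a) := sinh_pos_iff.2 (by positivity)
    refine one_div_le_one_div_of_le (by positivity) (pow_le_pow_left₀ this.le ?_ 2)
    refine sinh_le_sinh.2 ?_
    gcongr
    norm_num
  have h4 : HasSum (fun n : ℕ => 1 / sinh ((n + 1) * (a / 2)) ^ 2
      - 1 / cosh ((n + 1) * (a / 2)) ^ 2)
      ((b - d) + ((∑' n : ℕ, 1 / sinh ((n + 1) * a) ^ 2) - c)) := by
    refine HasSum.even_add_odd ((hb.sub hd).congr_fun fun n => ?_)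
      ((hs.hasSum.sub hc).congr_fun fun n => ?_) <;>
    · push_cast; ring_nf
  have h5 := h4.unique ((hs.hasSum.mul_left 4).congr_fun fun n => by
    rw [one_div_sinh_sq_sub_one_div_cosh_sq (by positivity)]; ring_nf)
  convert hs.hasSum using 1
  linarith

lemma ellipticK_abs (k : ℝ) : ellipticK |k| = ellipticK k := by simp [ellipticK]

lemma S2half_eq {x c d : ℝ}
    (hc : HasSum (fun n : ℕ => 1 / sinh ((n + 1) * (π * x)) ^ 2) c)
    (hd : HasSum (fun n : ℕ => 1 / cosh ((n + 1 / 2) * (π * x)) ^ 2) d) :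
    S2half x = π ^ 2 * x * (1 / 6 - c + d) := by
  rw [S2half, ← hc.tsum_eq, ← hd.tsum_eq,
    tsum_pnat_eq_tsum_succ (f := fun m : ℕ => 1 / sinh (π * m * x) ^ 2),
    tsum_pnat_eq_tsum_succ (f := fun m : ℕ => 1 / cosh (π * x * ((m : ℝ) - 1 / 2)) ^ 2)]
  congr 2
  · congr 1
    refine tsum_congr fun n => ?_
    push_cast; ring_nf
  · refine tsum_congr fun n => ?_
    push_cast; ring_nf

lemma exists_modulus {x : ℝ} (hx : 0 < x) :
    ∃ k ∈ Set.Ioo (0 : ℝ) 1, xRatio k = x ∧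
      S2half x = 2 * ellipticK (√(1 - k ^ 2)) *
        (2 * ellipticE k + ((4 * k ^ 2 - 5) / 3) * ellipticK k) := by
  have ha : 0 < π * x := by positivity
  set a := π * x with ha'
  have hBpos : 0 < (sechSum a (0 : ℝ)).re := by
    have := re_sechSum_pos (a := a) (x := 0) (y := 0) (M := 2 * exp 0) ha
      (by simpa using sechBound_ofReal (a := a) (t := 0) (R := 0) (by simp)) (by simp)
    simpa using this
  obtain ⟨A, hA, hB2, hK'⟩ := real_line_evaluation ha
  obtain ⟨hp, hlt, hK, hE⟩ := vertical_line_evaluation ha hBpos (by rw [hA]; exact hB2)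
  have hc := hasSum_sech_sq ha
  have hd := hasSum_sech_half_sq ha
  rw [S2half_eq (hasSum_csch_sq ha (hasSum_csch_half_sq ha) hc hd) hd]
  set B := (sechSum a (0 : ℝ)).re
  set D := (sechSum a ((a / 2 : ℝ) : ℂ)).re
  have hk : D / B ∈ Set.Ioo (0 : ℝ) 1 := ⟨by positivity, (div_lt_one hBpos).2 hlt⟩
  have hs : √(1 - (D / B) ^ 2) = |A / B| := by
    rw [← sqrt_sq_eq_abs]
    congr 1
    field_simp
    linarith
  have hK2 : ellipticK √(1 - (D / B) ^ 2) = a / 2 * B := by rw [hs, ellipticK_abs, hK']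
  have hE2 : B * ellipticE (D / B) = B * (π / 2 * B) - π / 2 * (sechConst a).re := by
    rw [hE, ← hK]; ring
  refine ⟨D / B, hk, ?_, ?_⟩
  · rw [xRatio, hK2, ← hK, ha']
    field_simp
  · rw [hK2, ← hK, show 2 * (a / 2 * B) * (2 * ellipticE (D / B) + (4 * (D / B) ^ 2 - 5) / 3 *
      (π / 2 * B)) = a * (2 * (B * ellipticE (D / B)) + (4 * (D / B) ^ 2 - 5) / 3 *
      (π / 2 * B ^ 2)) by ring, hE2, ha']
    field_simp
    ring

/-- Closed form of the lattice sum in terms of elliptic integrals. -/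
theorem S2half_closed_form (k : ℝ) (hk : k ∈ Set.Ioo (0:ℝ) 1) :
    S2half (xRatio k) =
      2 * ellipticK (Real.sqrt (1 - k ^ 2)) *
        (2 * ellipticE k + ((4 * k ^ 2 - 5) / 3) * ellipticK k) := by
  have h1 : k ^ 2 < 1 := by nlinarith [hk.1, hk.2]
  have h2 : 0 < k ^ 2 := by have := hk.1; positivity
  have hx : 0 < xRatio k :=
    div_pos (ellipticK_pos (by rw [sq_sqrt (by linarith)]; linarith)) (ellipticK_pos h1)
  obtain ⟨l, hl, hlx, h⟩ := exists_modulus hx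
  rwa [xRatio_injOn hl hk hlx] at h
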